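/- arXiv:1512.09211 — 2 statements merged into one kernel-verified Lean document; each statement's English description precedes it below -/
import Mathlib

section
/- Dual monogamy inequality for concurrence of assistance: for any N-qubit pure state |ψ⟩ on qubits A, B₁, …, B_{N−1} (N ≥ 2), C²(|ψ⟩_{A|B₁…B_{N−1}}) ≤ Σ_{i=1}^{N−1} C_a²(ρ_{AB_i}), where ρ_{AB_i} is the two-qubit reduced density matrix of |ψ⟩⟨ψ| on qubits A and B_i. -/
open scoped BigOperators

noncomputable section

/-- Partial trace over the second tensor factor:
`(ptraceRight ρ) s s' = ∑ t, ρ (s,t) (s',t)`. -/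
def ptraceRight {S T : Type*} [Fintype S] [Fintype T]
    (ρ : Matrix (S × T) (S × T) ℂ) : Matrix S S ℂ :=
  fun s s' => ∑ t : T, ρ (s, t) (s', t)

/-- Partial trace over the first tensor factor. -/
def ptraceLeft {S T : Type*} [Fintype S] [Fintype T]
    (ρ : Matrix (S × T) (S × T) ℂ) : Matrix T T ℂ :=
  fun t t' => ∑ s : S, ρ (s, t) (s, t')

/-- The density matrix `|ψ⟩⟨ψ|` of a (pure) state vector `ψ`. -/
def pureDM {d : Type*} (ψ : d → ℂ) : Matrix d d ℂ :=
  fun x y => ψ x * (starRingEnd ℂ) (ψ y)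

/-- `Tr(ρ²)` (real part) of a square matrix. -/
def trSq {S : Type*} [Fintype S] (ρ : Matrix S S ℂ) : ℝ :=
  ((ρ * ρ).trace).re

/-- Linear entropy `T(ρ) = 1 - Tr(ρ²)`. -/
def linEnt {S : Type*} [Fintype S] (ρ : Matrix S S ℂ) : ℝ :=
  1 - trSq ρ

/-- Concurrence of a bipartite pure state `ψ : S × T → ℂ` (with respect to the
bipartition `S | T`): `C(ψ) = √(2 (1 - Tr ρ_S²))`. -/
def pureConc {S T : Type*} [Fintype S] [Fintype T] (ψ : S × T → ℂ) : ℝ :=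
  Real.sqrt (2 * (1 - trSq (ptraceRight (pureDM ψ))))

/-- The set of average pure-state concurrences over all finite pure-state
ensembles realizing the bipartite density matrix `ρ`. -/
def concSet {S T : Type*} [Fintype S] [Fintype T]
    (ρ : Matrix (S × T) (S × T) ℂ) : Set ℝ :=
  { c | ∃ (n : ℕ) (p : Fin n → ℝ) (φ : Fin n → S × T → ℂ),
      (∀ i, 0 ≤ p i) ∧ (∑ i, p i = 1) ∧
      (∀ i, ∑ x, ‖φ i x‖ ^ 2 = 1) ∧
      (ρ = ∑ i, (p i : ℂ) • pureDM (φ i)) ∧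
      c = ∑ i, p i * pureConc (φ i) }

/-- Concurrence of a bipartite mixed state (convex-roof extension). -/
def conc {S T : Type*} [Fintype S] [Fintype T]
    (ρ : Matrix (S × T) (S × T) ℂ) : ℝ :=
  sInf (concSet ρ)

/-- Concurrence of assistance of a bipartite mixed state. -/
def concA {S T : Type*} [Fintype S] [Fintype T]
    (ρ : Matrix (S × T) (S × T) ℂ) : ℝ :=
  sSup (concSet ρ)

/-- Concurrence of an `N`-qubit pure state `ψ` across the cut given by the
predicate `P` (the qubits satisfying `P` versus the rest). -/
def qubitCut {N : ℕ} (P : Fin N → Prop) [DecidablePred P]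
    (ψ : (Fin N → Fin 2) → ℂ) : ℝ :=
  pureConc (fun x : ({i // P i} → Fin 2) × ({i // ¬ P i} → Fin 2) =>
    ψ ((Equiv.piEquivPiSubtypeProd P (fun _ => Fin 2)).symm x))

/-- Assemble a full `N`-qubit configuration from values `x` at qubit `u`,
`y` at qubit `v`, and `f` elsewhere. -/
def assemble2 {N : ℕ} (u v : Fin N) (x y : Fin 2)
    (f : {i : Fin N // i ≠ u ∧ i ≠ v} → Fin 2) : Fin N → Fin 2 :=
  fun i => if h : i = u then x else if h' : i = v then y else f ⟨i, h, h'⟩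

/-- The two-qubit reduced density matrix of the `N`-qubit pure state `ψ` on the
(ordered) pair of qubits `u, v`, obtained by tracing out all other qubits. -/
def rdm2 {N : ℕ} (u v : Fin N) (ψ : (Fin N → Fin 2) → ℂ) :
    Matrix (Fin 2 × Fin 2) (Fin 2 × Fin 2) ℂ :=
  fun x y => ∑ f : {i : Fin N // i ≠ u ∧ i ≠ v} → Fin 2,
    ψ (assemble2 u v x.1 x.2 f) * (starRingEnd ℂ) (ψ (assemble2 u v y.1 y.2 f))

/-- The reduced density matrix of the `N`-qubit pure state `ψ` obtained by
tracing out the single qubit `v`, organized as a bipartite state on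
qubit `u` versus all remaining qubits. -/
def rdm1Rest {N : ℕ} (u v : Fin N) (ψ : (Fin N → Fin 2) → ℂ) :
    Matrix (Fin 2 × ({i : Fin N // i ≠ u ∧ i ≠ v} → Fin 2))
           (Fin 2 × ({i : Fin N // i ≠ u ∧ i ≠ v} → Fin 2)) ℂ :=
  fun x y => ∑ t : Fin 2,
    ψ (assemble2 u v x.1 t x.2) * (starRingEnd ℂ) (ψ (assemble2 u v y.1 t y.2))

/-- The sum of the squared moduli of the `2 × 2` minors of a bipartite vector. -/
def minorSq {S T : Type*} [Fintype S] [Fintype T] (φ : S × T → ℂ) : ℝ :=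
  ∑ s, ∑ s', ∑ t, ∑ t', ‖φ (s, t) * φ (s', t') - φ (s, t') * φ (s', t)‖ ^ 2

lemma minorSq_nonneg {S T : Type*} [Fintype S] [Fintype T] (φ : S × T → ℂ) :
    0 ≤ minorSq φ := by
  unfold minorSq; positivity

lemma trSq_ptraceRight_pureDM {S T : Type*} [Fintype S] [Fintype T] (φ : S × T → ℂ) :
    trSq (ptraceRight (pureDM φ)) = ∑ s, ∑ s', ∑ t, ∑ t',
      (φ (s, t) * φ (s', t') * (starRingEnd ℂ) (φ (s, t') * φ (s', t))).re := by
  simp only [trSq, Matrix.trace, Matrix.diag, Matrix.mul_apply, ptraceRight, pureDM,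
    Finset.sum_mul_sum, Complex.re_sum, map_mul]
  refine Finset.sum_congr rfl fun s _ => Finset.sum_congr rfl fun s' _ =>
    Finset.sum_congr rfl fun t _ => Finset.sum_congr rfl fun t' _ => ?_
  congr 1
  ring

lemma trSq_ptraceRight_pureDM_nonneg {S T : Type*} [Fintype S] [Fintype T] (φ : S × T → ℂ) :
    0 ≤ trSq (ptraceRight (pureDM φ)) := by
  have h : ∀ s s', ptraceRight (pureDM φ) s' s
      = (starRingEnd ℂ) (ptraceRight (pureDM φ) s s') := by
    intro s s'
    simp only [ptraceRight, pureDM, map_sum, map_mul, Complex.conj_conj]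
    exact Finset.sum_congr rfl fun t _ => mul_comm _ _
  simp only [trSq, Matrix.trace, Matrix.diag, Matrix.mul_apply, Complex.re_sum]
  refine Finset.sum_nonneg fun s _ => Finset.sum_nonneg fun s' _ => ?_
  rw [h s s', Complex.mul_conj, Complex.ofReal_re]
  exact Complex.normSq_nonneg _

lemma minorSq_eq {S T : Type*} [Fintype S] [Fintype T] (φ : S × T → ℂ) :
    minorSq φ = 2 * ((∑ x, ‖φ x‖ ^ 2) ^ 2 - trSq (ptraceRight (pureDM φ))) := by
  have h1 : (∑ x, ‖φ x‖ ^ 2) ^ 2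
      = ∑ s, ∑ s', ∑ t, ∑ t', ‖φ (s, t)‖ ^ 2 * ‖φ (s', t')‖ ^ 2 := by
    simp only [Fintype.sum_prod_type, sq (∑ s, ∑ t, ‖φ (s, t)‖ ^ 2), Finset.sum_mul_sum]
  have h2 : (∑ x, ‖φ x‖ ^ 2) ^ 2
      = ∑ s, ∑ s', ∑ t, ∑ t', ‖φ (s, t')‖ ^ 2 * ‖φ (s', t)‖ ^ 2 := by
    rw [h1]
    exact Finset.sum_congr rfl fun s _ => Finset.sum_congr rfl fun s' _ => Finset.sum_comm
  have h3 : minorSq φ = (∑ x, ‖φ x‖ ^ 2) ^ 2 + (∑ x, ‖φ x‖ ^ 2) ^ 2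
      - 2 * trSq (ptraceRight (pureDM φ)) := by
    nth_rewrite 1 [h1]
    rw [h2, trSq_ptraceRight_pureDM, minorSq]
    simp only [Finset.mul_sum, ← Finset.sum_add_distrib, ← Finset.sum_sub_distrib]
    refine Finset.sum_congr rfl fun s _ => Finset.sum_congr rfl fun s' _ =>
      Finset.sum_congr rfl fun t _ => Finset.sum_congr rfl fun t' _ => ?_
    rw [Complex.sq_norm, Complex.normSq_sub]
    simp only [Complex.normSq_mul, Complex.sq_norm]
  rw [h3]; ring

lemma pureConc_eq_sqrt_minorSq {S T : Type*} [Fintype S] [Fintype T] (φ : S × T → ℂ)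
    (hφ : ∑ x, ‖φ x‖ ^ 2 = 1) : pureConc φ = √(minorSq φ) := by
  rw [minorSq_eq, hφ, one_pow, pureConc]

lemma bddAbove_concSet {S T : Type*} [Fintype S] [Fintype T]
    (ρ : Matrix (S × T) (S × T) ℂ) : BddAbove (concSet ρ) := by
  refine ⟨√2, ?_⟩
  rintro c ⟨n, p, φ, hp, hp1, -, -, rfl⟩
  calc ∑ i, p i * pureConc (φ i) ≤ ∑ i, p i * √2 := by
        refine Finset.sum_le_sum fun i _ => mul_le_mul_of_nonneg_left ?_ (hp i)
        exact Real.sqrt_le_sqrt (by linarith [trSq_ptraceRight_pureDM_nonneg (φ i)])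
    _ = √2 := by rw [← Finset.sum_mul, hp1, one_mul]

lemma minorSq_smul {S T : Type*} [Fintype S] [Fintype T] (c : ℂ) (φ : S × T → ℂ) :
    minorSq (c • φ) = (‖c‖ ^ 2) ^ 2 * minorSq φ := by
  simp only [minorSq, Finset.mul_sum]
  refine Finset.sum_congr rfl fun s _ => Finset.sum_congr rfl fun s' _ =>
    Finset.sum_congr rfl fun t _ => Finset.sum_congr rfl fun t' _ => ?_
  have : (c • φ) (s, t) * (c • φ) (s', t') - (c • φ) (s, t') * (c • φ) (s', t)
      = c ^ 2 * (φ (s, t) * φ (s', t') - φ (s, t') * φ (s', t)) := by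
    simp only [Pi.smul_apply, smul_eq_mul]
    ring
  rw [this, norm_mul, norm_pow, mul_pow]

lemma exists_unit_smul {d : Type*} [Fintype d] [Nonempty d] (φ : d → ℂ) :
    ∃ φ' : d → ℂ, ∑ x, ‖φ' x‖ ^ 2 = 1 ∧ φ = ((√(∑ x, ‖φ x‖ ^ 2) : ℝ) : ℂ) • φ' := by
  classical
  set p := ∑ x, ‖φ x‖ ^ 2 with hp
  have hp0 : 0 ≤ p := by positivity
  rcases hp0.eq_or_lt with h | h
  · refine ⟨Pi.single (Classical.arbitrary d) 1, ?_, ?_⟩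
    · rw [Finset.sum_eq_single (Classical.arbitrary d)] <;> simp +contextual
    · rw [← h]
      have := (Finset.sum_eq_zero_iff_of_nonneg (fun x _ => by positivity)).1 (hp.symm.trans h.symm)
      ext x
      simpa using this x (Finset.mem_univ x)
  · have hs : √p ≠ 0 := (Real.sqrt_pos.2 h).ne'
    refine ⟨((√p : ℝ) : ℂ)⁻¹ • φ, ?_, ?_⟩
    · simp only [Pi.smul_apply, smul_eq_mul, norm_mul, mul_pow, ← Finset.mul_sum, ← hp]
      rw [norm_inv, Complex.norm_real, inv_pow, Real.norm_eq_abs, sq_abs, Real.sq_sqrt hp0,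
        inv_mul_cancel₀ h.ne']
    · rw [smul_smul, mul_inv_cancel₀ (by exact_mod_cast hs), one_smul]

/-- A decomposition of `ρ` into unnormalised pure states gives a lower bound on the
concurrence of assistance. -/
lemma sum_sqrt_minorSq_le_concA {S T κ : Type*} [Fintype S] [Fintype T] [Fintype κ]
    [Nonempty (S × T)] (ρ : Matrix (S × T) (S × T) ℂ) (φ : κ → S × T → ℂ)
    (h1 : ∑ k, ∑ x, ‖φ k x‖ ^ 2 = 1) (hρ : ρ = ∑ k, pureDM (φ k)) :
    ∑ k, √(minorSq (φ k)) ≤ concA ρ := by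
  choose φ' hφ' hφ using fun k => exists_unit_smul (φ k)
  set p : κ → ℝ := fun k => ∑ x, ‖φ k x‖ ^ 2 with hp
  have hp0 : ∀ k, 0 ≤ p k := fun k => by positivity
  let e := (Fintype.equivFin κ).symm
  refine le_csSup (bddAbove_concSet ρ)
    ⟨Fintype.card κ, p ∘ e, φ' ∘ e, fun i => hp0 _, ?_, fun i => hφ' _, ?_, ?_⟩
  · exact (e.sum_comp p).trans h1
  · refine hρ.trans ?_
    refine Eq.trans ?_ (e.sum_comp fun k => (p k : ℂ) • pureDM (φ' k)).symm
    refine Finset.sum_congr rfl fun k _ => ?_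
    ext x y
    have hsq : ((√(p k) : ℝ) : ℂ) * ((√(p k) : ℝ) : ℂ) = (p k : ℂ) := by
      rw [← Complex.ofReal_mul, Real.mul_self_sqrt (hp0 k)]
    have hx : ∀ x, φ k x = ((√(p k) : ℝ) : ℂ) * φ' k x := fun x => congrFun (hφ k) x
    simp only [pureDM, Matrix.smul_apply, smul_eq_mul]
    rw [hx x, hx y, map_mul, Complex.conj_ofReal, ← hsq]
    ring
  · refine Eq.trans ?_ (e.sum_comp fun k => p k * pureConc (φ' k)).symm
    refine Finset.sum_congr rfl fun k _ => ?_
    rw [pureConc_eq_sqrt_minorSq _ (hφ' k), hφ k, minorSq_smul, Complex.norm_real,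
      Real.norm_eq_abs, sq_abs, Real.sq_sqrt (hp0 k), Real.sqrt_mul (sq_nonneg _),
      Real.sqrt_sq (hp0 k)]

lemma two_mul_sum_sq_le_sq_sum_abs {ι : Type*} [Fintype ι] (μ : ι → ℝ) (h : ∑ i, μ i = 0) :
    2 * ∑ i, μ i ^ 2 ≤ (∑ i, |μ i|) ^ 2 := by
  classical
  have key : ∀ i, 2 * |μ i| ≤ ∑ j, |μ j| := by
    intro i
    have h1 := Finset.add_sum_erase Finset.univ μ (Finset.mem_univ i)
    have h2 := Finset.add_sum_erase Finset.univ (fun j => |μ j|) (Finset.mem_univ i)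
    have h3 := Finset.abs_sum_le_sum_abs μ (Finset.univ.erase i)
    have h4 : |μ i| = |∑ j ∈ Finset.univ.erase i, μ j| := by
      rw [← abs_neg]; congr 1; linarith
    linarith
  calc 2 * ∑ i, μ i ^ 2 = ∑ i, (2 * |μ i|) * |μ i| := by
        rw [Finset.mul_sum]
        exact Finset.sum_congr rfl fun i _ => by rw [← sq_abs]; ring
    _ ≤ ∑ i, (∑ j, |μ j|) * |μ i| :=
        Finset.sum_le_sum fun i _ => mul_le_mul_of_nonneg_right (key i) (abs_nonneg _)
    _ = _ := by rw [← Finset.mul_sum, sq]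

open Matrix in
lemma exists_orthogonal_diagonalization {ι : Type*} [Fintype ι] [DecidableEq ι]
    (A : Matrix ι ι ℝ) (hA : Aᵀ = A) :
    ∃ (μ : ι → ℝ) (U : Matrix ι ι ℝ), U * Uᵀ = 1 ∧ Uᵀ * A * U = diagonal μ := by
  have hH : A.IsHermitian := by rwa [Matrix.IsHermitian, conjTranspose_eq_transpose_of_trivial]
  refine ⟨hH.eigenvalues, hH.eigenvectorUnitary, ?_, ?_⟩
  · have := Unitary.coe_mul_star_self hH.eigenvectorUnitary
    rwa [Unitary.coe_star, star_eq_conjTranspose, conjTranspose_eq_transpose_of_trivial] at this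
  · have := hH.conjStarAlgAut_star_eigenvectorUnitary
    rw [Unitary.conjStarAlgAut_star_apply, star_eq_conjTranspose,
      conjTranspose_eq_transpose_of_trivial] at this
    simpa using this

open Matrix in
/-- A resolution of the identity by vectors on which a complex symmetric bilinear form `τ` is
large: the total modulus of its values is at least the Frobenius norm of `τ`. -/
lemma exists_frame_frobenius_le {ι : Type*} [Fintype ι] [DecidableEq ι]
    (τ : Matrix ι ι ℂ) (hτ : ∀ f g, τ f g = τ g f) :
    ∃ e : ι ⊕ ι → ι → ℂ,
      (∀ f g, ∑ k, e k f * (starRingEnd ℂ) (e k g) = if f = g then 1 else 0) ∧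
      ∑ f, ∑ g, ‖τ f g‖ ^ 2 ≤ (∑ k, ‖∑ f, ∑ g, e k f * e k g * τ f g‖) ^ 2 := by
  let R : Matrix ι ι ℝ := fun f g => (τ f g).re
  let I : Matrix ι ι ℝ := fun f g => (τ f g).im
  have hRa : ∀ f g, R f g = (τ f g).re := fun _ _ => rfl
  have hIa : ∀ f g, I f g = (τ f g).im := fun _ _ => rfl
  have hR : Rᵀ = R := by ext f g; rw [transpose_apply, hRa, hRa, hτ]
  have hI : Iᵀ = I := by ext f g; rw [transpose_apply, hIa, hIa, hτ]
  let A : Matrix (ι ⊕ ι) (ι ⊕ ι) ℝ := fromBlocks R (-I) (-I) (-R)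
  have hA : Aᵀ = A := by simp [A, fromBlocks_transpose, hR, hI]
  obtain ⟨μ, U, hU, hD⟩ := exists_orthogonal_diagonalization A hA
  have hsum : ∑ k, μ k = 0 := by
    rw [← trace_diagonal, ← hD, trace_mul_comm, ← Matrix.mul_assoc, hU, Matrix.one_mul]
    simp [A, trace, Fintype.sum_sum_type]
  have hsq : ∑ k, μ k ^ 2 = 2 * ∑ f, ∑ g, ‖τ f g‖ ^ 2 := by
    have h1 : ∑ k, μ k ^ 2 = trace (A * A) := by
      have : diagonal (fun k => μ k ^ 2) = Uᵀ * (A * A) * U := by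
        calc diagonal (fun k => μ k ^ 2) = diagonal μ * diagonal μ := by
              simp [diagonal_mul_diagonal, sq]
          _ = Uᵀ * A * (U * Uᵀ) * A * U := by rw [← hD]; simp only [Matrix.mul_assoc]
          _ = _ := by rw [hU, Matrix.mul_one]; simp only [Matrix.mul_assoc]
      rw [← trace_diagonal, this, trace_mul_comm, ← Matrix.mul_assoc, hU, Matrix.one_mul]
    rw [h1]
    have h3 : trace (A * A) = 2 * (trace (R * R) + trace (I * I)) := by
      simp only [A, fromBlocks_multiply, neg_mul_neg, trace, diag, Fintype.sum_sum_type,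
        fromBlocks_apply₁₁, fromBlocks_apply₂₂, Matrix.add_apply, Finset.sum_add_distrib]
      ring
    have h2 : trace (R * R) + trace (I * I) = ∑ f, ∑ g, ‖τ f g‖ ^ 2 := by
      simp only [trace, diag, Matrix.mul_apply, ← Finset.sum_add_distrib]
      refine Finset.sum_congr rfl fun f _ => Finset.sum_congr rfl fun g _ => ?_
      rw [Complex.sq_norm, Complex.normSq_apply]
      simp only [hRa, hIa, hτ g f]
    rw [h3, h2]
  have hc : √(1 / 2 : ℝ) * √(1 / 2) = 1 / 2 := Real.mul_self_sqrt (by norm_num)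
  set c := √(1 / 2 : ℝ)
  let e : ι ⊕ ι → ι → ℂ := fun k f => ⟨c * U (Sum.inl f) k, c * U (Sum.inr f) k⟩
  have hUU : ∀ a b, ∑ k, U a k * U b k = if a = b then 1 else 0 := by
    intro a b
    rw [← Matrix.one_apply, ← hU, Matrix.mul_apply]
    rfl
  refine ⟨e, fun f g => ?_, ?_⟩
  · apply Complex.ext
    · have h : (∑ k, e k f * (starRingEnd ℂ) (e k g)).re
          = 1 / 2 * (∑ k, U (Sum.inl f) k * U (Sum.inl g) k
            + ∑ k, U (Sum.inr f) k * U (Sum.inr g) k) := by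
        rw [Complex.re_sum, ← Finset.sum_add_distrib, Finset.mul_sum]
        refine Finset.sum_congr rfl fun k _ => ?_
        simp only [e, Complex.mul_re, Complex.conj_re, Complex.conj_im]
        rw [← hc]; ring
      rw [h, hUU, hUU]
      by_cases hfg : f = g
      · norm_num [hfg]
      · simp [hfg]
    · have h : (∑ k, e k f * (starRingEnd ℂ) (e k g)).im
          = 1 / 2 * (∑ k, U (Sum.inr f) k * U (Sum.inl g) k
            - ∑ k, U (Sum.inl f) k * U (Sum.inr g) k) := by
        rw [Complex.im_sum, ← Finset.sum_sub_distrib, Finset.mul_sum]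
        refine Finset.sum_congr rfl fun k _ => ?_
        simp only [e, Complex.mul_im, Complex.conj_re, Complex.conj_im]
        rw [← hc]; ring
      rw [h, hUU, hUU]
      by_cases hfg : f = g <;> simp [hfg]
  · have hre : ∀ k, (∑ f, ∑ g, e k f * e k g * τ f g).re = 1 / 2 * μ k := by
      intro k
      have h : μ k = (Uᵀ * A * U) k k := by rw [hD, diagonal_apply_eq]
      rw [h, Matrix.mul_assoc]
      simp only [Matrix.mul_apply, Fintype.sum_sum_type, A, transpose_apply, fromBlocks_apply₁₁,
        fromBlocks_apply₁₂, fromBlocks_apply₂₁, fromBlocks_apply₂₂, Complex.re_sum,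
        Finset.mul_sum, mul_add, ← Finset.sum_add_distrib]
      refine Finset.sum_congr rfl fun f _ => Finset.sum_congr rfl fun g _ => ?_
      simp only [e, Complex.mul_re, Complex.mul_im, Matrix.neg_apply, hRa, hIa]
      rw [← hc]; ring
    have hle : 1 / 2 * ∑ k, |μ k| ≤ ∑ k, ‖∑ f, ∑ g, e k f * e k g * τ f g‖ := by
      rw [Finset.mul_sum]
      refine Finset.sum_le_sum fun k _ => ?_
      refine le_trans (le_of_eq ?_) (Complex.abs_re_le_norm _)
      rw [hre, abs_mul]; norm_num
    have h0 : 0 ≤ 1 / 2 * ∑ k, |μ k| := by positivity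
    have h2 := two_mul_sum_sq_le_sq_sum_abs μ hsum
    have h3 := pow_le_pow_left₀ h0 hle 2
    nlinarith

/-- The bilinear form `⟨φ*| σ_y ⊗ σ_y |χ⟩` on two-qubit vectors, up to sign. -/
def spinFlipForm (φ χ : Fin 2 × Fin 2 → ℂ) : ℂ :=
  φ (0, 0) * χ (1, 1) + φ (1, 1) * χ (0, 0) - φ (0, 1) * χ (1, 0) - φ (1, 0) * χ (0, 1)

lemma sqrt_minorSq_eq_norm_spinFlipForm (φ : Fin 2 × Fin 2 → ℂ) :
    √(minorSq φ) = ‖spinFlipForm φ φ‖ := by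
  rw [Real.sqrt_eq_iff_mul_self_eq (minorSq_nonneg φ) (norm_nonneg _)]
  have h1 : spinFlipForm φ φ = 2 * (φ (0, 0) * φ (1, 1) - φ (0, 1) * φ (1, 0)) := by
    simp only [spinFlipForm]; ring
  have h2 : φ (0, 1) * φ (1, 0) - φ (0, 0) * φ (1, 1)
      = -(φ (0, 0) * φ (1, 1) - φ (0, 1) * φ (1, 0)) := by ring
  have h3 : φ (1, 0) * φ (0, 1) - φ (1, 1) * φ (0, 0)
      = -(φ (0, 0) * φ (1, 1) - φ (0, 1) * φ (1, 0)) := by ring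
  have h4 : φ (1, 1) * φ (0, 0) - φ (1, 0) * φ (0, 1)
      = φ (0, 0) * φ (1, 1) - φ (0, 1) * φ (1, 0) := by ring
  have h5 : ∀ a b c d, φ a * φ b - φ c * φ d = φ a * φ b - φ d * φ c := by intros; ring
  rw [h1, norm_mul]
  simp only [minorSq, Fin.sum_univ_two, sub_self, norm_zero]
  rw [h2, h3, h4, norm_neg, h5 (0, 0) (0, 1), h5 (0, 1) (0, 0), h5 (1, 0) (1, 1), h5 (1, 1) (1, 0)]
  simp only [mul_comm, sub_self, norm_zero, Complex.norm_ofNat]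
  ring

/-- The concurrence of assistance of a two-qubit state dominates `Tr (ρ ρ̃)`. -/
lemma sum_sq_spinFlipForm_le_concA_sq {ι : Type*} [Fintype ι] (φ : ι → Fin 2 × Fin 2 → ℂ)
    (ρ : Matrix (Fin 2 × Fin 2) (Fin 2 × Fin 2) ℂ) (hρ : ρ = ∑ f, pureDM (φ f))
    (h1 : ∑ f, ∑ x, ‖φ f x‖ ^ 2 = 1) :
    ∑ f, ∑ g, ‖spinFlipForm (φ f) (φ g)‖ ^ 2 ≤ concA ρ ^ 2 := by
  classical
  obtain ⟨e, he, hle⟩ := exists_frame_frobenius_le (fun f g => spinFlipForm (φ f) (φ g))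
    (fun f g => by simp only [spinFlipForm]; ring)
  let χ : ι ⊕ ι → Fin 2 × Fin 2 → ℂ := fun k x => ∑ f, e k f * φ f x
  have hform : ∀ k, spinFlipForm (χ k) (χ k)
      = ∑ f, ∑ g, e k f * e k g * spinFlipForm (φ f) (φ g) := by
    intro k
    simp only [spinFlipForm, χ, Finset.sum_mul_sum, ← Finset.sum_add_distrib,
      ← Finset.sum_sub_distrib]
    exact Finset.sum_congr rfl fun f _ => Finset.sum_congr rfl fun g _ => by ring
  have hχ : ∀ x y, ∑ k, χ k x * (starRingEnd ℂ) (χ k y)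
      = ∑ f, φ f x * (starRingEnd ℂ) (φ f y) := by
    intro x y
    calc ∑ k, χ k x * (starRingEnd ℂ) (χ k y)
        = ∑ k, ∑ f, ∑ g, e k f * (starRingEnd ℂ) (e k g)
            * (φ f x * (starRingEnd ℂ) (φ g y)) := by
          refine Finset.sum_congr rfl fun k _ => ?_
          simp only [χ, map_sum, map_mul, Finset.sum_mul_sum]
          exact Finset.sum_congr rfl fun f _ => Finset.sum_congr rfl fun g _ => by ring
      _ = ∑ f, ∑ g, (∑ k, e k f * (starRingEnd ℂ) (e k g))
            * (φ f x * (starRingEnd ℂ) (φ g y)) := by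
          rw [Finset.sum_comm]
          refine Finset.sum_congr rfl fun f _ => ?_
          rw [Finset.sum_comm]
          exact Finset.sum_congr rfl fun g _ => by rw [Finset.sum_mul]
      _ = _ := by simp [he]
  have hχ1 : ∑ k, ∑ x, ‖χ k x‖ ^ 2 = 1 := by
    rw [← h1, Finset.sum_comm, Finset.sum_comm (s := (Finset.univ : Finset ι))]
    refine Finset.sum_congr rfl fun x _ => ?_
    have := hχ x x
    simp only [Complex.mul_conj, Complex.normSq_eq_norm_sq] at this
    exact_mod_cast this
  have hρχ : ρ = ∑ k, pureDM (χ k) := by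
    rw [hρ]
    ext x y
    simpa only [Matrix.sum_apply, pureDM] using (hχ x y).symm
  refine hle.trans (pow_le_pow_left₀ (by positivity) ?_ 2)
  refine le_trans (le_of_eq ?_) (sum_sqrt_minorSq_le_concA ρ χ hχ1 hρχ)
  exact Finset.sum_congr rfl fun k _ => by rw [sqrt_minorSq_eq_norm_spinFlipForm, hform]

lemma sq_norm_sub_add_sq_norm_sub_le (a b c d : ℂ) :
    ‖a - d‖ ^ 2 + ‖b - c‖ ^ 2 ≤ ‖a - b‖ ^ 2 + ‖c - d‖ ^ 2 + ‖a - c‖ ^ 2 + ‖b - d‖ ^ 2 := by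
  simp only [Complex.sq_norm, Complex.normSq_apply, Complex.sub_re, Complex.sub_im]
  nlinarith [sq_nonneg (a.re - b.re - c.re + d.re), sq_nonneg (a.im - b.im - c.im + d.im)]

lemma sum_sq_norm_sub_comp_le {X : Type*} [Fintype X] (σ τ : X → X)
    (hσ : Function.Involutive σ) (hτ : Function.Involutive τ)
    (hστ : ∀ x, σ (τ x) = τ (σ x)) (W : X → ℂ) :
    ∑ x, ‖W x - W (σ (τ x))‖ ^ 2 ≤ ∑ x, ‖W x - W (σ x)‖ ^ 2 + ∑ x, ‖W x - W (τ x)‖ ^ 2 := by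
  have h1 := Equiv.sum_comp (hσ.toPerm σ) fun x => ‖W x - W (σ (τ x))‖ ^ 2
  have h2 := Equiv.sum_comp (hτ.toPerm τ) fun x => ‖W x - W (σ x)‖ ^ 2
  have h3 := Equiv.sum_comp (hσ.toPerm σ) fun x => ‖W x - W (τ x)‖ ^ 2
  simp only [Function.Involutive.coe_toPerm, ← hστ, hσ _] at h1 h2 h3
  have h := Finset.sum_le_sum fun x (_ : x ∈ Finset.univ) =>
    sq_norm_sub_add_sq_norm_sub_le (W x) (W (σ x)) (W (τ x)) (W (σ (τ x)))
  simp only [Finset.sum_add_distrib] at h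
  linarith

/-- Exchange the entries of two configurations at the sites in `S`. -/
def swapOn {ι β : Type*} [DecidableEq ι] (S : Finset ι) (z : (ι → β) × (ι → β)) :
    (ι → β) × (ι → β) :=
  (fun i => if i ∈ S then z.2 i else z.1 i, fun i => if i ∈ S then z.1 i else z.2 i)

section swapOn

variable {ι β : Type*} [DecidableEq ι]

lemma swapOn_involutive (S : Finset ι) : Function.Involutive (swapOn (β := β) S) := by
  intro z
  ext i <;> by_cases h : i ∈ S <;> simp [swapOn, h]

lemma swapOn_comm (S T : Finset ι) (z : (ι → β) × (ι → β)) :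
    swapOn S (swapOn T z) = swapOn T (swapOn S z) := by
  ext i <;> by_cases h : i ∈ S <;> by_cases h' : i ∈ T <;> simp [swapOn, h, h']

lemma swapOn_empty (z : (ι → β) × (ι → β)) : swapOn ∅ z = z := by
  simp [swapOn]

lemma swapOn_insert {i : ι} {S : Finset ι} (hi : i ∉ S) (z : (ι → β) × (ι → β)) :
    swapOn (insert i S) z = swapOn {i} (swapOn S z) := by
  ext j <;> by_cases h : j = i <;> by_cases h' : j ∈ S <;> simp_all [swapOn]

lemma swapOn_univ [Fintype ι] (z : (ι → β) × (ι → β)) :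
    swapOn Finset.univ z = z.swap := by
  simp [swapOn, Prod.swap]

lemma sum_sq_norm_sub_swapOn_le [Fintype ι] [Fintype β] (S : Finset ι)
    (W : (ι → β) × (ι → β) → ℂ) :
    ∑ z, ‖W z - W (swapOn S z)‖ ^ 2 ≤ ∑ i ∈ S, ∑ z, ‖W z - W (swapOn {i} z)‖ ^ 2 := by
  induction S using Finset.induction_on with
  | empty => simp [swapOn_empty]
  | insert i S hi ih =>
    rw [Finset.sum_insert hi]
    simp only [swapOn_insert hi]
    exact (sum_sq_norm_sub_comp_le _ _ (swapOn_involutive _) (swapOn_involutive _)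
      (swapOn_comm _ _) W).trans (by gcongr)

end swapOn

section assemble2

variable {N : ℕ} {u v : Fin N}

lemma sum_assemble2 {M : Type*} [AddCommMonoid M] (huv : u ≠ v) (F : (Fin N → Fin 2) → M) :
    ∑ x, F x = ∑ f, ∑ p : Fin 2 × Fin 2, F (assemble2 u v p.1 p.2 f) := by
  rw [← Fintype.sum_prod_type']
  symm
  refine Fintype.sum_bijective
    (fun q : ({i : Fin N // i ≠ u ∧ i ≠ v} → Fin 2) × (Fin 2 × Fin 2) =>
      assemble2 u v q.2.1 q.2.2 q.1) ?_ _ _ fun _ => rfl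
  refine Function.bijective_iff_has_inverse.2
    ⟨fun x => (fun i => x i, (x u, x v)), fun q => ?_, fun x => ?_⟩
  · ext i
    · simp [assemble2, i.2.1, i.2.2]
    · simp [assemble2]
    · simp [assemble2, huv.symm]
  · ext i
    by_cases h : i = u
    · subst h; simp [assemble2]
    · by_cases h' : i = v
      · subst h'; simp [assemble2, h]
      · simp [assemble2, h, h']

lemma swapOn_singleton_assemble2_left (a b c d : Fin 2)
    (f g : {i : Fin N // i ≠ u ∧ i ≠ v} → Fin 2) :
    swapOn {u} (assemble2 u v a b f, assemble2 u v c d g)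
      = (assemble2 u v c b f, assemble2 u v a d g) := by
  refine Prod.ext (funext fun i => ?_) (funext fun i => ?_) <;> by_cases h : i = u <;>
    simp [swapOn, assemble2, h]

lemma swapOn_singleton_assemble2_right (huv : u ≠ v) (a b c d : Fin 2)
    (f g : {i : Fin N // i ≠ u ∧ i ≠ v} → Fin 2) :
    swapOn {v} (assemble2 u v a b f, assemble2 u v c d g)
      = (assemble2 u v a d f, assemble2 u v c b g) := by
  refine Prod.ext (funext fun i => ?_) (funext fun i => ?_) <;> by_cases h : i = v <;>
    by_cases h' : i = u <;> simp_all [swapOn, assemble2]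

end assemble2

lemma sum_sq_mixed_minors_eq (φ χ : Fin 2 × Fin 2 → ℂ) :
    ∑ p : Fin 2 × Fin 2, ∑ q : Fin 2 × Fin 2,
      ‖φ p * χ q - φ (q.1, p.2) * χ (p.1, q.2)
        - (φ (p.1, q.2) * χ (q.1, p.2) - φ q * χ p)‖ ^ 2
      = 4 * ‖spinFlipForm φ χ‖ ^ 2 := by
  simp only [Fintype.sum_prod_type, Fin.sum_univ_two, sub_self, spinFlipForm,
    Complex.sq_norm, Complex.normSq_apply, Complex.sub_re, Complex.sub_im, Complex.add_re,
    Complex.add_im]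
  ring

/-- The squared defect of `ψ ⊗ ψ` under exchanging qubit `u` and then qubit `v` of the two copies
is controlled by the concurrence of assistance of the pair. -/
lemma sum_sq_swap_defect_le {N : ℕ} {u v : Fin N} (huv : u ≠ v) (ψ : (Fin N → Fin 2) → ℂ)
    (hψ : ∑ x, ‖ψ x‖ ^ 2 = 1) (Ψ W : (Fin N → Fin 2) × (Fin N → Fin 2) → ℂ)
    (hΨ : ∀ z, Ψ z = ψ z.1 * ψ z.2) (hW : ∀ z, W z = Ψ z - Ψ (swapOn {u} z)) :
    ∑ z, ‖W z - W (swapOn {v} z)‖ ^ 2 ≤ 4 * concA (rdm2 u v ψ) ^ 2 := by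
  let φ : ({i : Fin N // i ≠ u ∧ i ≠ v} → Fin 2) → Fin 2 × Fin 2 → ℂ :=
    fun f p => ψ (assemble2 u v p.1 p.2 f)
  have hρ : rdm2 u v ψ = ∑ f, pureDM (φ f) := by
    ext x y
    simp only [Matrix.sum_apply, pureDM, rdm2, φ]
  have h1 : ∑ f, ∑ x, ‖φ f x‖ ^ 2 = 1 := by
    rw [← hψ, sum_assemble2 huv]
  have h := sum_sq_spinFlipForm_le_concA_sq φ _ hρ h1
  refine le_trans (le_of_eq ?_) (mul_le_mul_of_nonneg_left h (by norm_num : (0 : ℝ) ≤ 4))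
  rw [Fintype.sum_prod_type, sum_assemble2 huv, Finset.mul_sum]
  refine Finset.sum_congr rfl fun f _ => ?_
  simp only [sum_assemble2 huv (M := ℝ)]
  rw [Finset.sum_comm, Finset.mul_sum]
  refine Finset.sum_congr rfl fun g _ => ?_
  rw [← sum_sq_mixed_minors_eq]
  simp only [hW, hΨ, swapOn_singleton_assemble2_left, swapOn_singleton_assemble2_right huv, φ]

lemma qubitCut_sq {N : ℕ} (P : Fin N → Prop) [DecidablePred P] (ψ : (Fin N → Fin 2) → ℂ)
    (hψ : ∑ x, ‖ψ x‖ ^ 2 = 1) (S : Finset (Fin N)) (hS : ∀ i, i ∈ S ↔ P i) :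
    qubitCut P ψ ^ 2 = ∑ z : (Fin N → Fin 2) × (Fin N → Fin 2),
      ‖ψ z.1 * ψ z.2 - ψ (swapOn S z).1 * ψ (swapOn S z).2‖ ^ 2 := by
  let e := Equiv.piEquivPiSubtypeProd P (fun _ => Fin 2)
  have hnorm : ∑ x, ‖ψ (e.symm x)‖ ^ 2 = 1 := by
    rw [← hψ]; exact e.symm.sum_comp fun x => ‖ψ x‖ ^ 2
  rw [qubitCut, pureConc_eq_sqrt_minorSq _ hnorm, Real.sq_sqrt (minorSq_nonneg _),
    ← (e.symm.prodCongr e.symm).sum_comp, minorSq]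
  simp only [Fintype.sum_prod_type]
  refine Finset.sum_congr rfl fun s _ => ?_
  rw [Finset.sum_comm]
  refine Finset.sum_congr rfl fun t _ => Finset.sum_congr rfl fun s' _ =>
    Finset.sum_congr rfl fun t' _ => ?_
  have h1 : (swapOn S (e.symm (s, t), e.symm (s', t'))).1 = e.symm (s', t) := by
    ext i; by_cases h : P i <;> simp [swapOn, e, Equiv.piEquivPiSubtypeProd, hS, h]
  have h2 : (swapOn S (e.symm (s, t), e.symm (s', t'))).2 = e.symm (s, t') := by
    ext i; by_cases h : P i <;> simp [swapOn, e, Equiv.piEquivPiSubtypeProd, hS, h]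
  simp only [Equiv.prodCongr_apply, Prod.map_apply, h1, h2]
  rw [mul_comm (ψ (e.symm (s', t)))]

lemma qubitCut_sq_le_sum_concA_sq {N : ℕ} (u : Fin N) (ψ : (Fin N → Fin 2) → ℂ)
    (hψ : ∑ x, ‖ψ x‖ ^ 2 = 1) :
    qubitCut (fun i : Fin N => i = u) ψ ^ 2
      ≤ ∑ v ∈ Finset.univ.erase u, concA (rdm2 u v ψ) ^ 2 := by
  let Ψ : (Fin N → Fin 2) × (Fin N → Fin 2) → ℂ := fun z => ψ z.1 * ψ z.2
  let W : (Fin N → Fin 2) × (Fin N → Fin 2) → ℂ := fun z => Ψ z - Ψ (swapOn {u} z)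
  have hswap : ∀ z, Ψ z.swap = Ψ z := fun z => mul_comm _ _
  have hall : ∀ z : (Fin N → Fin 2) × (Fin N → Fin 2),
      swapOn {u} (swapOn (Finset.univ.erase u) z) = z.swap := by
    intro z
    rw [← swapOn_insert (Finset.notMem_erase u _), Finset.insert_erase (Finset.mem_univ u),
      swapOn_univ]
  have hrest : ∀ z : (Fin N → Fin 2) × (Fin N → Fin 2),
      swapOn (Finset.univ.erase u) z = (swapOn {u} z).swap := by
    intro z
    rw [← hall, swapOn_comm, swapOn_involutive]
  have hanti : ∀ z, W (swapOn (Finset.univ.erase u) z) = -W z := by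
    intro z
    simp only [W]
    rw [hall, hrest, hswap, hswap]
    ring
  have hcut : 4 * qubitCut (fun i : Fin N => i = u) ψ ^ 2
      = ∑ z, ‖W z - W (swapOn (Finset.univ.erase u) z)‖ ^ 2 := by
    rw [qubitCut_sq _ ψ hψ {u} (fun i => Finset.mem_singleton), Finset.mul_sum]
    refine Finset.sum_congr rfl fun z _ => ?_
    rw [hanti, sub_neg_eq_add, ← two_mul, norm_mul, mul_pow]
    norm_num [W, Ψ]
  have h := sum_sq_norm_sub_swapOn_le (Finset.univ.erase u) W
  have h' := Finset.sum_le_sum fun v (hv : v ∈ Finset.univ.erase u) =>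
    sum_sq_swap_defect_le (Finset.ne_of_mem_erase hv).symm ψ hψ Ψ W (fun _ => rfl) fun _ => rfl
  rw [← Finset.mul_sum] at h'
  linarith

/-- Dual monogamy inequality: for an `N`-qubit pure state on qubits
`A, B₁, …, B_{N-1}`, `C²(ψ_{A|B₁…B_{N-1}}) ≤ ∑ᵢ C_a²(ρ_{AB_i})`.
Qubits: `A = 0`, `B_i = i` for `i = 1, …, N - 1`. -/
theorem dual_monogamy_concurrence_of_assistance
    (N : ℕ) (hN : 2 ≤ N) (ψ : (Fin N → Fin 2) → ℂ)
    (hψ : ∑ x, ‖ψ x‖ ^ 2 = 1) :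
    (qubitCut (fun i : Fin N => i = (⟨0, by omega⟩ : Fin N)) ψ) ^ 2 ≤
      ∑ i : Fin (N - 1), (concA (rdm2 (⟨0, by omega⟩ : Fin N) (⟨(i : ℕ) + 1, by have := i.isLt; omega⟩ : Fin N) ψ)) ^ 2 := by
  obtain ⟨n, rfl⟩ : ∃ n, N = n + 1 := ⟨N - 1, by omega⟩
  refine (qubitCut_sq_le_sum_concA_sq _ ψ hψ).trans (le_of_eq ?_)
  have h : Finset.univ.erase (0 : Fin (n + 1)) = Finset.univ.map (Fin.succEmb n) := by
    ext i
    refine Fin.cases ?_ (fun j => ?_) i <;> simp [Fin.succ_ne_zero]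
  exact (congrArg (fun s => ∑ v ∈ s, concA (rdm2 0 v ψ) ^ 2) h).trans
    (Finset.sum_map Finset.univ (Fin.succEmb n) fun v => concA (rdm2 0 v ψ) ^ 2)

end
end

section
/- Monogamy of squared concurrence (generalized Coffman–Kundu–Wootters inequality): for any N-qubit pure state |ψ⟩ on qubits A, B₁, …, B_{N−1} (N ≥ 2), C²(|ψ⟩_{A|B₁…B_{N−1}}) ≥ Σ_{i=1}^{N−1} C²(ρ_{AB_i}), where ρ_{AB_i} is the two-qubit reduced density matrix of |ψ⟩⟨ψ| on qubits A and B_i and C(ρ_{AB_i}) is the mixed-state concurrence. -/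
open scoped BigOperators

noncomputable section

section

open scoped Matrix ComplexOrder
open Module Filter Topology

lemma exists_unit_coneigenvector {E : Type*} [NormedAddCommGroup E]
    [InnerProductSpace ℂ E] [FiniteDimensional ℂ E] [Nontrivial E] (T : E →+ E)
    (hsmul : ∀ (r : ℝ) x, T ((r : ℂ) • x) = (r : ℂ) • T x)
    (hT : ∀ x y, inner ℂ (T x) y = inner ℂ (T y) x) :
    ∃ x : E, ‖x‖ = 1 ∧ ∃ l : ℝ, T x = (l : ℂ) • x := by
  let _ : InnerProductSpace ℝ E := InnerProductSpace.complexToReal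
  have : FiniteDimensional ℝ E := FiniteDimensional.complexToReal E
  let TR : E →ₗ[ℝ] E :=
    { toFun := T, map_add' := T.map_add, map_smul' := fun r x => hsmul r x }
  have hsym : TR.IsSymmetric := by
    intro x y
    change Complex.re (inner ℂ (T x) y) = Complex.re (inner ℂ x (T y))
    rw [hT, ← inner_conj_symm, Complex.conj_re]
  obtain ⟨x, hx⟩ := hsym.hasEigenvalue_iSup_of_finiteDimensional.exists_hasEigenvector
  have hx1 := hx.apply_eq_smul
  generalize (⨆ x : { x : E // x ≠ 0 }, _ : ℝ) = l at hx1
  refine ⟨((‖x‖⁻¹ : ℝ) : ℂ) • x, ?_, l, ?_⟩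
  · rw [norm_smul, Complex.norm_real, norm_inv, norm_norm,
      inv_mul_cancel₀ (norm_ne_zero_iff.2 hx.2)]
  · have : T x = (l : ℂ) • x := hx1
    rw [hsmul, this, smul_comm]

lemma exists_orthonormal_coneigenvectors {E : Type*} [NormedAddCommGroup E]
    [InnerProductSpace ℂ E] [FiniteDimensional ℂ E] (T : E →+ E)
    (hsmul : ∀ (r : ℝ) x, T ((r : ℂ) • x) = (r : ℂ) • T x)
    (hT : ∀ x y, inner ℂ (T x) y = inner ℂ (T y) x) (k : ℕ) (hk : k ≤ finrank ℂ E) :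
    ∃ v : Fin k → E, Orthonormal ℂ v ∧ ∀ i, ∃ l : ℝ, T (v i) = (l : ℂ) • v i := by
  induction k with
  | zero => exact ⟨Fin.elim0, ⟨fun i => i.elim0, fun i => i.elim0⟩, fun i => i.elim0⟩
  | succ k ih =>
    obtain ⟨v, hv, hvT⟩ := ih (by omega)
    set K : Submodule ℂ E := (Submodule.span ℂ (Set.range v))ᗮ with hK
    have hmem : ∀ y, y ∈ K ↔ ∀ i, inner ℂ (v i) y = 0 := by
      intro y
      rw [hK, Submodule.mem_orthogonal]
      refine ⟨fun h i => h _ (Submodule.subset_span ⟨i, rfl⟩), fun h u hu => ?_⟩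
      induction hu using Submodule.span_induction with
      | mem x hx => obtain ⟨i, rfl⟩ := hx; exact h i
      | zero => simp
      | add x y _ _ hx hy => simp [inner_add_left, hx, hy]
      | smul a x _ hx => simp [inner_smul_left, hx]
    have hinv : ∀ y ∈ K, T y ∈ K := by
      intro y hy
      rw [hmem] at hy ⊢
      intro i
      obtain ⟨l, hl⟩ := hvT i
      rw [← inner_conj_symm, hT, hl, inner_smul_left, hy i]
      simp
    have hpos : 0 < finrank ℂ K := by
      have h1 := Submodule.finrank_add_finrank_orthogonal (Submodule.span ℂ (Set.range v))
      have h2 := finrank_span_eq_card hv.linearIndependent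
      rw [Fintype.card_fin] at h2
      rw [hK]
      omega
    have : Nontrivial K := Module.nontrivial_of_finrank_pos hpos
    obtain ⟨x, hx, l, hl⟩ := exists_unit_coneigenvector (E := K)
      { toFun := fun y => ⟨T y, hinv y y.2⟩
        map_zero' := by ext; simp
        map_add' := fun a b => by ext; simp }
      (fun r y => Subtype.ext (hsmul r y)) (fun y z => hT y z)
    refine ⟨Matrix.vecCons (x : E) v, orthonormal_vecCons_iff.2 ⟨hx, fun i => ?_, hv⟩,
      Fin.cases ⟨l, congrArg Subtype.val hl⟩ hvT⟩
    rw [← inner_conj_symm, (hmem x).1 x.2 i, map_zero]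

/-- Every complex symmetric matrix is diagonalized by a unitary congruence (Autonne–Takagi). -/
lemma exists_unitary_transpose_mul_mul_diagonal {n : ℕ} (τ : Matrix (Fin n) (Fin n) ℂ)
    (hτ : τᵀ = τ) : ∃ U ∈ Matrix.unitaryGroup (Fin n) ℂ,
      ∀ i j, i ≠ j → (Uᵀ * τ * U) i j = 0 := by
  have hin : ∀ x y : EuclideanSpace ℂ (Fin n), inner ℂ x y = ∑ i, star (x i) * y i := by
    intro x y
    simp [PiLp.inner_apply, mul_comm]
  let T : EuclideanSpace ℂ (Fin n) →+ EuclideanSpace ℂ (Fin n) :=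
    { toFun := fun x => WithLp.toLp 2 fun i => star (∑ j, τ i j * x j)
      map_zero' := by ext; simp
      map_add' := fun x y => by ext; simp [mul_add, Finset.sum_add_distrib] }
  have hTa : ∀ x i, T x i = star (∑ j, τ i j * x j) := fun x i => rfl
  have hTin : ∀ x y, inner ℂ (T x) y = ∑ i, ∑ j, x j * τ i j * y i := by
    intro x y
    simp only [hin, hTa, star_star, Finset.sum_mul]
    exact Finset.sum_congr rfl fun i _ => Finset.sum_congr rfl fun j _ => by ring
  obtain ⟨v, hv, hvT⟩ := exists_orthonormal_coneigenvectors T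
    (fun r x => by ext i; simp [hTa, Finset.mul_sum, mul_left_comm])
    (fun x y => by
      rw [hTin, hTin, Finset.sum_comm]
      refine Finset.sum_congr rfl fun i _ => Finset.sum_congr rfl fun j _ => ?_
      rw [← congrFun (congrFun hτ i) j, Matrix.transpose_apply]
      ring) n (by simp)
  have hvv := orthonormal_iff_ite.1 hv
  refine ⟨Matrix.of fun a i => v i a, ?_, fun i j hij => ?_⟩
  · rw [Matrix.mem_unitaryGroup_iff']
    ext i j
    rw [Matrix.mul_apply, Matrix.one_apply, ← hvv i j, hin]
    simp
  · obtain ⟨l, hl⟩ := hvT i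
    have h : inner ℂ (T (v i)) (v j) = 0 := by
      rw [hl, inner_smul_left, hv.2 hij, mul_zero]
    rw [hTin] at h
    rw [← h]
    simp only [Matrix.mul_apply, Matrix.transpose_apply, Matrix.of_apply, Finset.sum_mul]
    refine Finset.sum_congr rfl fun a _ => Finset.sum_congr rfl fun b _ => ?_
    rw [← congrFun (congrFun hτ a) b, Matrix.transpose_apply]

/-- The polarization of the determinant on `2 × 2` matrices. -/
def detPolar (P Q : Matrix (Fin 2) (Fin 2) ℂ) : ℂ :=
  P 0 0 * Q 1 1 + P 1 1 * Q 0 0 - P 0 1 * Q 1 0 - P 1 0 * Q 0 1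

lemma trace_adjugate_mul (P Q : Matrix (Fin 2) (Fin 2) ℂ) :
    (P.adjugate * Q).trace = detPolar P Q := by
  rw [Matrix.adjugate_fin_two, Matrix.trace_fin_two, Matrix.mul_apply, Matrix.mul_apply, detPolar]
  simp
  ring

lemma detPolar_mul_left (R P Q : Matrix (Fin 2) (Fin 2) ℂ) :
    detPolar (R * P) (R * Q) = R.det * detPolar P Q := by
  simp [Matrix.det_fin_two, Matrix.mul_apply, detPolar]
  ring

lemma mul_add_mul_of_trace_eq_zero {P Q : Matrix (Fin 2) (Fin 2) ℂ}
    (hP : P.trace = 0) (hQ : Q.trace = 0) :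
    P * Q + Q * P = (-detPolar P Q) • (1 : Matrix (Fin 2) (Fin 2) ℂ) := by
  rw [Matrix.trace_fin_two] at hP hQ
  have h1 : P 1 1 = -P 0 0 := by linear_combination hP
  have h2 : Q 1 1 = -Q 0 0 := by linear_combination hQ
  ext i j
  fin_cases i <;> fin_cases j <;> simp [Matrix.mul_apply, detPolar, h1, h2] <;> ring

lemma mul_self_of_trace_eq_zero {P : Matrix (Fin 2) (Fin 2) ℂ}
    (hP : P.trace = 0) : P * P = (-P.det) • (1 : Matrix (Fin 2) (Fin 2) ℂ) := by
  rw [Matrix.trace_fin_two] at hP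
  have h1 : P 1 1 = -P 0 0 := by linear_combination hP
  ext i j
  fin_cases i <;> fin_cases j <;> simp [Matrix.mul_apply, Matrix.det_fin_two, h1] <;> ring

/-- A matrix commuting with two anticommuting traceless invertible matrices is scalar. -/
lemma eq_smul_one_of_commute {X P Q : Matrix (Fin 2) (Fin 2) ℂ}
    (hP : P.trace = 0) (hP2 : P * P = -1) (hQ2 : Q * Q = -1)
    (hPQ : P * Q = -(Q * P)) (hXP : X * P = P * X) (hXQ : X * Q = Q * X) :
    ∃ g : ℂ, X = g • (1 : Matrix (Fin 2) (Fin 2) ℂ) := by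
  set Y := X - (X.trace / 2) • (1 : Matrix (Fin 2) (Fin 2) ℂ) with hY
  have hYt : Y.trace = 0 := by simp [hY]
  have key : ∀ {R : Matrix (Fin 2) (Fin 2) ℂ}, R.trace = 0 → R * R = -1 →
      X * R = R * X → ∃ a : ℂ, Y = a • R := by
    intro R hR hR2 hXR
    have hc : R * Y = Y * R := by simp [hY, mul_sub, sub_mul, hXR]
    have h := mul_add_mul_of_trace_eq_zero hYt hR
    rw [hc, ← two_smul ℂ] at h
    refine ⟨detPolar Y R / 2, ?_⟩
    have h' : Y * R = (-detPolar Y R / 2) • (1 : Matrix (Fin 2) (Fin 2) ℂ) := by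
      rw [div_eq_inv_mul, mul_smul, ← h, smul_smul]
      norm_num
    calc Y = -(Y * R * R) := by rw [mul_assoc, hR2]; simp
      _ = _ := by rw [h', smul_mul_assoc, one_mul, ← neg_smul]; congr 1; ring
  obtain ⟨a, ha⟩ := key hP hP2 hXP
  have hYQ : Y * Q = Q * Y := by simp [hY, mul_sub, sub_mul, hXQ]
  have h0 : Y = 0 := by
    have h1 : Y * Q = 0 := by
      have h2 : Y * Q = -(Y * Q) := by
        nth_rewrite 1 [ha]
        rw [smul_mul_assoc, hPQ, smul_neg, ← mul_smul_comm, ← ha, hYQ]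
      have h3 : (2 : ℂ) • (Y * Q) = 0 := by
        rw [two_smul]
        nth_rewrite 2 [h2]
        exact add_neg_cancel _
      exact (smul_eq_zero.1 h3).resolve_left two_ne_zero
    calc Y = -(Y * Q * Q) := by rw [mul_assoc, hQ2]; simp
      _ = 0 := by rw [h1]; simp
  exact ⟨X.trace / 2, sub_eq_zero.1 h0⟩

/-- The sum of `B * Bᴴ` over the unit quaternions `1, P, Q, P * Q`. -/
def quaternionSum (P Q : Matrix (Fin 2) (Fin 2) ℂ) : Matrix (Fin 2) (Fin 2) ℂ :=
  1 + P * Pᴴ + Q * Qᴴ + P * Q * (P * Q)ᴴ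

lemma quaternionSum_conj_left {P Q : Matrix (Fin 2) (Fin 2) ℂ}
    (hP : P * P = -1) :
    P * quaternionSum P Q * Pᴴ = quaternionSum P Q := by
  have h1 : P * (P * Pᴴ) * Pᴴ = 1 := by
    rw [← mul_assoc, hP, neg_one_mul, neg_mul, ← Matrix.conjTranspose_mul, hP]; simp
  have h2 : P * (P * Q * (P * Q)ᴴ) * Pᴴ = Q * Qᴴ := by
    have : P * (P * Q) = -Q := by rw [← mul_assoc, hP, neg_one_mul]
    rw [← mul_assoc, this, mul_assoc, ← Matrix.conjTranspose_mul, this]; simp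
  have h3 : P * (Q * Qᴴ) * Pᴴ = P * Q * (P * Q)ᴴ := by
    rw [Matrix.conjTranspose_mul]; simp only [mul_assoc]
  simp only [quaternionSum, mul_add, add_mul, h1, h2, h3, mul_one]
  abel

lemma quaternionSum_conj_right {P Q : Matrix (Fin 2) (Fin 2) ℂ}
    (hQ : Q * Q = -1) (hPQ : P * Q = -(Q * P)) :
    Q * quaternionSum P Q * Qᴴ = quaternionSum P Q := by
  have : quaternionSum P Q = quaternionSum Q P := by
    simp only [quaternionSum, hPQ, Matrix.conjTranspose_neg, neg_mul_neg]
    abel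
  rw [this]
  exact quaternionSum_conj_left hQ

lemma quaternionSum_posDef (P Q : Matrix (Fin 2) (Fin 2) ℂ) : (quaternionSum P Q).PosDef :=
  ((Matrix.PosDef.one.add_posSemidef (Matrix.posSemidef_self_mul_conjTranspose P)).add_posSemidef
    (Matrix.posSemidef_self_mul_conjTranspose Q)).add_posSemidef
    (Matrix.posSemidef_self_mul_conjTranspose (P * Q))

lemma quaternionSum_conj_third {P Q R : Matrix (Fin 2) (Fin 2) ℂ}
    (hP : P.trace = 0) (hP2 : P * P = -1) (hQ2 : Q * Q = -1)
    (hdR : R.det = 1) (hdP : P.det = 1) (hdQ : Q.det = 1)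
    (hPQ : P * Q = -(Q * P)) (hPR : P * R = -(R * P)) (hQR : Q * R = -(R * Q)) :
    R * quaternionSum P Q * Rᴴ = quaternionSum P Q := by
  obtain ⟨g, hg⟩ := eq_smul_one_of_commute (X := R * P * Q) hP hP2 hQ2 hPQ
    (by
      calc R * P * Q * P = R * P * (Q * P) := mul_assoc _ _ _
        _ = -(R * P * (P * Q)) := by rw [hPQ]; simp
        _ = P * R * (P * Q) := by rw [hPR]; simp
        _ = _ := by simp only [mul_assoc])
    (by
      calc R * P * Q * Q = R * (P * Q) * Q := by simp only [mul_assoc]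
        _ = -(R * (Q * P) * Q) := by rw [hPQ]; simp
        _ = -(R * Q * (P * Q)) := by simp only [mul_assoc]
        _ = Q * R * (P * Q) := by rw [hQR]; simp
        _ = _ := by simp only [mul_assoc])
  have hR : R = g • (Q * P) := by
    calc R = R * P * Q * (Q * P) := by
          rw [mul_assoc, ← mul_assoc Q, hQ2, neg_one_mul, mul_neg, mul_assoc, hP2]; simp
      _ = _ := by rw [hg, smul_mul_assoc, one_mul]
  have hg2 : g ^ 2 = 1 := by
    have := congrArg Matrix.det hg
    simpa [hdR, hdP, hdQ] using this.symm
  have hgg : g * star g = 1 := by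
    rcases mul_self_eq_one_iff.1 ((sq g).symm.trans hg2) with h | h <;> simp [h]
  rw [hR, Matrix.conjTranspose_smul, smul_mul_assoc, smul_mul_smul_comm, hgg, one_smul,
    Matrix.conjTranspose_mul]
  calc Q * P * quaternionSum P Q * (Pᴴ * Qᴴ) = Q * (P * quaternionSum P Q * Pᴴ) * Qᴴ := by
        simp only [mul_assoc]
    _ = _ := by rw [quaternionSum_conj_left hP2, quaternionSum_conj_right hQ2 hPQ]

lemma det_smul_add_smul (x y : ℂ) (P Q : Matrix (Fin 2) (Fin 2) ℂ) :
    (x • P + y • Q).det = x ^ 2 * P.det + y ^ 2 * Q.det + x * y * detPolar P Q := by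
  simp [Matrix.det_fin_two, detPolar]
  ring

lemma exists_isHermitian_of_detPolar_eq_zero {N : Fin 4 → Matrix (Fin 2) (Fin 2) ℂ}
    (hdet : ∀ i, (N i).det = 1) (hpol : ∀ i j, i ≠ j → detPolar (N i) (N j) = 0)
    (w : Fin 4 → ℝ) {c : ℝ} (hc : 0 ≤ c) (hc1 : c ≤ |w 0 + w 1 - w 2 - w 3|)
    (hc2 : c ≤ |w 0 - w 1 + w 2 - w 3|) :
    ∃ H : Matrix (Fin 2) (Fin 2) ℂ, H.IsHermitian ∧
      (∑ i, (w i : ℂ) • (N i * H * (N i)ᴴ)).trace.re = 0 ∧ 0 < -H.det.re ∧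
      c ^ 2 * (-H.det.re) ≤ -(∑ i, (w i : ℂ) • (N i * H * (N i)ᴴ)).det.re := by
  set B : Fin 4 → Matrix (Fin 2) (Fin 2) ℂ := fun i => (N 0).adjugate * N i with hB
  have hN : ∀ i, N i = N 0 * B i := by
    intro i
    rw [hB, ← mul_assoc, Matrix.mul_adjugate, hdet, one_smul, one_mul]
  have hB0 : B 0 = 1 := by simp [hB, Matrix.adjugate_mul, hdet]
  have hBdet : ∀ i, (B i).det = 1 := by simp [hB, Matrix.det_adjugate, hdet]
  have hBtr : ∀ i, i ≠ 0 → (B i).trace = 0 := fun i hi => by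
    simp only [hB, trace_adjugate_mul, hpol 0 i hi.symm]
  have hBpol : ∀ i j, i ≠ j → detPolar (B i) (B j) = 0 := fun i j hij => by
    simp only [hB, detPolar_mul_left, hpol i j hij, mul_zero]
  clear_value B
  have hB2 : ∀ i, i ≠ 0 → B i * B i = -1 := fun i hi => by
    rw [mul_self_of_trace_eq_zero (hBtr i hi), hBdet, neg_smul, one_smul]
  have hanti : ∀ i j, i ≠ 0 → j ≠ 0 → i ≠ j → B i * B j = -(B j * B i) := by
    intro i j hi hj hij
    have := mul_add_mul_of_trace_eq_zero (hBtr i hi) (hBtr j hj)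
    rw [hBpol i j hij, neg_zero, zero_smul] at this
    exact eq_neg_of_add_eq_zero_left this
  set G := quaternionSum (B 1) (B 2) with hG
  have hGpd : G.PosDef := quaternionSum_posDef _ _
  have hconj : ∀ i, B i * G * (B i)ᴴ = G := by
    intro i
    fin_cases i
    · simp [hB0]
    · exact quaternionSum_conj_left (hB2 1 (by decide))
    · exact quaternionSum_conj_right (hB2 2 (by decide)) (hanti 1 2 (by decide) (by decide)
        (by decide))
    · exact quaternionSum_conj_third (hBtr 1 (by decide)) (hB2 1 (by decide))
        (hB2 2 (by decide)) (hBdet 3) (hBdet 1) (hBdet 2)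
        (hanti 1 2 (by decide) (by decide) (by decide))
        (hanti 1 3 (by decide) (by decide) (by decide))
        (hanti 2 3 (by decide) (by decide) (by decide))
  have hherm : ∀ i, i ≠ 0 → (B i * G)ᴴ = -(B i * G) := by
    intro i hi
    rw [Matrix.conjTranspose_mul, hGpd.isHermitian.eq]
    calc G * (B i)ᴴ = -(B i * B i * G * (B i)ᴴ) := by rw [hB2 i hi]; simp
      _ = -(B i * (B i * G * (B i)ᴴ)) := by simp only [mul_assoc]
      _ = _ := by rw [hconj]
  set K : Fin 4 → Matrix (Fin 2) (Fin 2) ℂ := fun j => N 0 * (B j * G) * (N 0)ᴴ with hK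
  have hNK : ∀ i j, N i * (B j * G) * (N i)ᴴ = N 0 * (B i * B j * G * (B i)ᴴ) * (N 0)ᴴ := by
    intro i j
    rw [hN i, Matrix.conjTranspose_mul]
    simp only [mul_assoc]
  have hcomm : ∀ i j, B i * B j = B j * B i → N i * (B j * G) * (N i)ᴴ = K j := by
    intro i j h
    rw [hNK, h, mul_assoc (B j), mul_assoc (B j), hconj]
  have hncomm : ∀ i j, B i * B j = -(B j * B i) → N i * (B j * G) * (N i)ᴴ = -K j := by
    intro i j h
    rw [hNK, h, neg_mul, neg_mul, mul_assoc (B j), mul_assoc (B j), hconj]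
    simp [hK]
  set s₁ := w 0 + w 1 - w 2 - w 3 with hs₁
  set s₂ := w 0 - w 1 + w 2 - w 3 with hs₂
  have hsum : ∀ x y : ℝ, ∑ i, (w i : ℂ) • (N i *
        (Complex.I • ((x : ℂ) • (B 1 * G) + (y : ℂ) • (B 2 * G))) * (N i)ᴴ) =
      Complex.I • (((x * s₁ : ℝ) : ℂ) • K 1 + ((y * s₂ : ℝ) : ℂ) • K 2) := by
    intro x y
    have e : ∀ i, N i * (Complex.I • ((x : ℂ) • (B 1 * G) + (y : ℂ) • (B 2 * G))) * (N i)ᴴ =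
        Complex.I • ((x : ℂ) • (N i * (B 1 * G) * (N i)ᴴ) +
          (y : ℂ) • (N i * (B 2 * G) * (N i)ᴴ)) := by
      intro i
      simp only [mul_smul_comm, smul_mul_assoc, mul_add, add_mul]
    simp only [e, Fin.sum_univ_four]
    rw [hcomm 0 1 (by simp [hB0]), hcomm 0 2 (by simp [hB0]), hcomm 1 1 rfl, hcomm 2 2 rfl,
      hncomm 1 2 (hanti 1 2 (by decide) (by decide) (by decide)),
      hncomm 2 1 (hanti 2 1 (by decide) (by decide) (by decide)),
      hncomm 3 1 (hanti 3 1 (by decide) (by decide) (by decide)),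
      hncomm 3 2 (hanti 3 2 (by decide) (by decide) (by decide)), hs₁, hs₂]
    push_cast
    module
  have hdetG : G.det = (G.det.re : ℂ) := by
    refine (Complex.conj_eq_iff_re.1 ?_).symm
    rw [← Complex.star_def, ← Matrix.det_conjTranspose, hGpd.isHermitian.eq]
  have hdetGpos : 0 < G.det.re := (Complex.pos_iff.1 hGpd.det_pos).1
  have hdetB : ∀ x y : ℝ, (Complex.I • ((x : ℂ) • (B 1 * G) + (y : ℂ) • (B 2 * G))).det =
      ((-((x ^ 2 + y ^ 2) * G.det.re) : ℝ) : ℂ) := by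
    intro x y
    rw [← smul_mul_assoc, ← smul_mul_assoc, ← add_mul, ← smul_mul_assoc, Matrix.det_mul,
      Matrix.det_smul, det_smul_add_smul, hBdet, hBdet, hBpol 1 2 (by decide), hdetG]
    simp
    ring
  have hdetK : ∀ x y : ℝ, (Complex.I • ((x : ℂ) • K 1 + (y : ℂ) • K 2)).det =
      ((-((x ^ 2 + y ^ 2) * G.det.re) : ℝ) : ℂ) := by
    intro x y
    rw [← hdetB x y]
    have : Complex.I • ((x : ℂ) • K 1 + (y : ℂ) • K 2) =
        N 0 * (Complex.I • ((x : ℂ) • (B 1 * G) + (y : ℂ) • (B 2 * G))) * (N 0)ᴴ := by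
      simp only [hK, mul_smul_comm, smul_mul_assoc, mul_add, add_mul]
    rw [this, Matrix.det_mul, Matrix.det_mul, Matrix.det_conjTranspose, hdet]
    simp
  obtain ⟨x, y, hxy, hlin⟩ : ∃ x y : ℝ, 0 < x ^ 2 + y ^ 2 ∧
      x * (s₁ * (Complex.I * (K 1).trace).re) + y * (s₂ * (Complex.I * (K 2).trace).re) = 0 := by
    generalize s₁ * (Complex.I * (K 1).trace).re = a
    generalize s₂ * (Complex.I * (K 2).trace).re = b
    by_cases ha : a = 0
    · exact ⟨1, 0, by norm_num, by simp [ha]⟩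
    · exact ⟨b, -a, by nlinarith [sq_pos_of_pos (abs_pos.2 ha), sq_abs a, sq_nonneg b], by ring⟩
  refine ⟨Complex.I • ((x : ℂ) • (B 1 * G) + (y : ℂ) • (B 2 * G)), ?_, ?_, ?_, ?_⟩
  · rw [Matrix.IsHermitian, Matrix.conjTranspose_smul, Matrix.conjTranspose_add,
      Matrix.conjTranspose_smul, Matrix.conjTranspose_smul, hherm 1 (by decide),
      hherm 2 (by decide)]
    simp only [Complex.star_def, Complex.conj_I, Complex.conj_ofReal]
    module
  · rw [hsum, ← hlin]
    simp
    ring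
  · rw [hdetB, Complex.ofReal_re, neg_neg]
    positivity
  · rw [hsum, hdetB, hdetK, Complex.ofReal_re, Complex.ofReal_re, neg_neg, neg_neg, ← mul_assoc]
    refine mul_le_mul_of_nonneg_right ?_ hdetGpos.le
    have h1 : c ^ 2 ≤ s₁ ^ 2 := by rw [← sq_abs s₁]; gcongr
    have h2 : c ^ 2 ≤ s₂ ^ 2 := by rw [← sq_abs s₂]; gcongr
    nlinarith [mul_le_mul_of_nonneg_left h1 (sq_nonneg x),
      mul_le_mul_of_nonneg_left h2 (sq_nonneg y)]

/-- The (unnormalized) two-qubit density matrix `∑ i, |Mᵢ⟩⟨Mᵢ|` of an ensemble of vectors,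
each written as its `2 × 2` matrix of amplitudes. -/
def ensembleDM {ι : Type*} [Fintype ι] (M : ι → Matrix (Fin 2) (Fin 2) ℂ) :
    Matrix (Fin 2 × Fin 2) (Fin 2 × Fin 2) ℂ :=
  Matrix.of fun x y => ∑ i, M i x.1 x.2 * star (M i y.1 y.2)

/-- Contraction of the second qubit of `ρ` with the matrix `H`. -/
def contractSnd (ρ : Matrix (Fin 2 × Fin 2) (Fin 2 × Fin 2) ℂ)
    (H : Matrix (Fin 2) (Fin 2) ℂ) : Matrix (Fin 2) (Fin 2) ℂ :=
  Matrix.of fun a a' => ∑ b, ∑ b', ρ (a, b) (a', b') * H b b'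

/-- The rank-one matrix built from the `k`-th column of `U`. -/
def colProj (U : Matrix (Fin 2) (Fin 2) ℂ) (k : Fin 2) : Matrix (Fin 2) (Fin 2) ℂ :=
  Matrix.of fun b b' => U b k * star (U b' k)

/-- The unnormalized state of the first qubit of `ρ` conditional on outcome `k` of a
measurement of the second qubit in the basis of columns of `U`. -/
def condState (ρ : Matrix (Fin 2 × Fin 2) (Fin 2 × Fin 2) ℂ) (U : Matrix (Fin 2) (Fin 2) ℂ)
    (k : Fin 2) : Matrix (Fin 2) (Fin 2) ℂ :=
  contractSnd ρ (colProj U k)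

/-- The probability of outcome `k` of a measurement of the second qubit of `ρ`. -/
def outcomeProb (ρ : Matrix (Fin 2 × Fin 2) (Fin 2 × Fin 2) ℂ) (U : Matrix (Fin 2) (Fin 2) ℂ)
    (k : Fin 2) : ℝ :=
  (condState ρ U k).trace.re

lemma contractSnd_ensembleDM {ι : Type*} [Fintype ι] (M : ι → Matrix (Fin 2) (Fin 2) ℂ)
    (H : Matrix (Fin 2) (Fin 2) ℂ) :
    contractSnd (ensembleDM M) H = ∑ i, M i * H * (M i)ᴴ := by
  ext a a'
  simp only [contractSnd, ensembleDM, Matrix.of_apply, Matrix.sum_apply, Matrix.mul_apply,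
    Matrix.conjTranspose_apply, Fin.sum_univ_two, Finset.sum_mul, ← Finset.sum_add_distrib]
  exact Finset.sum_congr rfl fun i _ => by ring

lemma ensembleDM_mix {ι κ : Type*} [Fintype ι] [Fintype κ] [DecidableEq ι]
    (M : ι → Matrix (Fin 2) (Fin 2) ℂ) (V : Matrix κ ι ℂ) (hV : Vᴴ * V = 1) :
    ensembleDM (fun k => ∑ i, V k i • M i) = ensembleDM M := by
  ext x y
  simp only [ensembleDM, Matrix.of_apply, Matrix.sum_apply, Matrix.smul_apply, smul_eq_mul,
    star_sum, star_mul', Finset.sum_mul_sum]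
  rw [Finset.sum_comm]
  refine Finset.sum_congr rfl fun i _ => ?_
  rw [Finset.sum_comm]
  have h : ∀ j, ∑ k, V k i * M i x.1 x.2 * (star (V k j) * star (M j y.1 y.2)) =
      (if j = i then 1 else 0) * (M i x.1 x.2 * star (M j y.1 y.2)) := by
    intro j
    rw [← Matrix.one_apply, ← hV, Matrix.mul_apply, Finset.sum_mul]
    refine Finset.sum_congr rfl fun k _ => ?_
    rw [Matrix.conjTranspose_apply]
    ring
  rw [Finset.sum_congr rfl fun j _ => h j]
  simp

lemma exists_unitary_of_isHermitian (ρ : Matrix (Fin 2 × Fin 2) (Fin 2 × Fin 2) ℂ)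
    {H : Matrix (Fin 2) (Fin 2) ℂ} (hH : H.IsHermitian) {c : ℝ}
    (htr : (contractSnd ρ H).trace.re = 0) (hneg : 0 < -H.det.re)
    (hc : c * (-H.det.re) ≤ -(contractSnd ρ H).det.re) :
    ∃ U ∈ Matrix.unitaryGroup (Fin 2) ℂ,
      c * (outcomeProb ρ U 0 * outcomeProb ρ U 1) ≤
        -((outcomeProb ρ U 1 : ℂ) • condState ρ U 0 -
          (outcomeProb ρ U 0 : ℂ) • condState ρ U 1).det.re := by
  set U : Matrix (Fin 2) (Fin 2) ℂ := hH.eigenvectorUnitary.1 with hU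
  set h := hH.eigenvalues with hh
  have hspec : H = (h 0 : ℂ) • colProj U 0 + (h 1 : ℂ) • colProj U 1 := by
    have h1 := hH.spectral_theorem
    rw [Unitary.conjStarAlgAut_apply] at h1
    have h2 : H = U * Matrix.diagonal (fun k => (h k : ℂ)) * Uᴴ := h1
    clear_value U h
    rw [h2]
    ext i j
    simp [Matrix.mul_apply, colProj, Fin.sum_univ_two, Matrix.diagonal]
    ring
  have hdet : H.det.re = h 0 * h 1 := by
    rw [hH.det_eq_prod_eigenvalues]
    simp [Fin.prod_univ_two, hh]
  have hcon : contractSnd ρ H =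
      (h 0 : ℂ) • condState ρ U 0 + (h 1 : ℂ) • condState ρ U 1 := by
    rw [hspec]
    ext i j
    simp only [contractSnd, condState, Matrix.add_apply, Matrix.smul_apply, Matrix.of_apply,
      smul_eq_mul, Finset.mul_sum, ← Finset.sum_add_distrib]
    exact Finset.sum_congr rfl fun _ _ => Finset.sum_congr rfl fun _ _ => by ring
  have htr' : h 0 * outcomeProb ρ U 0 + h 1 * outcomeProb ρ U 1 = 0 := by
    rw [← htr, hcon]
    simp [outcomeProb]
  have h0 : h 0 ≠ 0 := by
    intro h0
    rw [hdet, h0] at hneg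
    simp at hneg
  have hp : outcomeProb ρ U 0 = -(h 1 * (outcomeProb ρ U 1 / h 0)) := by
    field_simp
    linarith
  refine ⟨U, hH.eigenvectorUnitary.2, ?_⟩
  have hcomb : (outcomeProb ρ U 1 : ℂ) • condState ρ U 0 -
      (outcomeProb ρ U 0 : ℂ) • condState ρ U 1 =
      ((outcomeProb ρ U 1 / h 0 : ℝ) : ℂ) • contractSnd ρ H := by
    have e : outcomeProb ρ U 1 = (outcomeProb ρ U 1 / h 0) * h 0 := by field_simp
    rw [hcon, hp]
    nth_rewrite 1 [e]
    push_cast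
    module
  rw [hcomb, Matrix.det_smul, Fintype.card_fin, ← Complex.ofReal_pow, Complex.re_ofReal_mul]
  have := mul_le_mul_of_nonneg_left hc (sq_nonneg (outcomeProb ρ U 1 / h 0))
  rw [hdet] at this
  calc c * (outcomeProb ρ U 0 * outcomeProb ρ U 1)
      = (outcomeProb ρ U 1 / h 0) ^ 2 * (c * -(h 0 * h 1)) := by rw [hp]; field_simp
    _ ≤ _ := this
    _ = _ := by ring

lemma detPolar_comm (P Q : Matrix (Fin 2) (Fin 2) ℂ) : detPolar P Q = detPolar Q P := by
  simp only [detPolar]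
  ring

lemma detPolar_self (P : Matrix (Fin 2) (Fin 2) ℂ) : detPolar P P = 2 * P.det := by
  simp only [detPolar, Matrix.det_fin_two]
  ring

lemma detPolar_sum_smul {n : ℕ} (M : Fin n → Matrix (Fin 2) (Fin 2) ℂ) (x y : Fin n → ℂ) :
    detPolar (∑ i, x i • M i) (∑ j, y j • M j) =
      ∑ i, ∑ j, x i * detPolar (M i) (M j) * y j := by
  simp only [detPolar, Matrix.sum_apply, Matrix.smul_apply, smul_eq_mul, Finset.sum_mul_sum,
    ← Finset.sum_add_distrib, ← Finset.sum_sub_distrib]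
  exact Finset.sum_congr rfl fun i _ => Finset.sum_congr rfl fun j _ => by ring

lemma det_sum_smul {n : ℕ} {M : Fin n → Matrix (Fin 2) (Fin 2) ℂ}
    (hpol : ∀ i j, i ≠ j → detPolar (M i) (M j) = 0) (x : Fin n → ℂ) :
    (∑ i, x i • M i).det = ∑ i, x i ^ 2 * (M i).det := by
  have h := detPolar_self (∑ i, x i • M i)
  rw [detPolar_sum_smul] at h
  have h2 : ∀ i, ∑ j, x i * detPolar (M i) (M j) * x j = 2 * (x i ^ 2 * (M i).det) := by
    intro i
    rw [Finset.sum_eq_single i (fun j _ hj => by rw [hpol i j hj.symm]; ring) (by simp),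
      detPolar_self]
    ring
  simp only [h2, ← Finset.mul_sum] at h
  exact (mul_left_cancel₀ two_ne_zero h).symm

/-- The `4 × 4` Hadamard matrix, normalized to be unitary. -/
noncomputable def hadamard : Matrix (Fin 4) (Fin 4) ℂ :=
  !![1/2, 1/2, 1/2, 1/2; 1/2, -1/2, 1/2, -1/2; 1/2, 1/2, -1/2, -1/2; 1/2, -1/2, -1/2, 1/2]

lemma hadamard_conjTranspose_mul_self : hadamardᴴ * hadamard = 1 := by
  ext i j
  fin_cases i <;> fin_cases j <;>
    simp [hadamard, Matrix.mul_apply, Fin.sum_univ_four, map_ofNat (starRingEnd ℂ) 2] <;> norm_num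

lemma hadamard_sq (i j : Fin 4) : hadamard i j ^ 2 = 1 / 4 := by
  fin_cases i <;> fin_cases j <;> simp [hadamard] <;> norm_num

lemma exists_ensemble_of_phases {M : Fin 4 → Matrix (Fin 2) (Fin 2) ℂ}
    (hpol : ∀ i j, i ≠ j → detPolar (M i) (M j) = 0) (z : Fin 4 → ℂ) (hz : ∀ i, ‖z i‖ = 1) :
    ∃ M' : Fin 4 → Matrix (Fin 2) (Fin 2) ℂ, ensembleDM M' = ensembleDM M ∧
      ∑ i, ‖(M' i).det‖ = ‖∑ i, z i ^ 2 * (M i).det‖ := by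
  refine ⟨fun k => ∑ i, (hadamard * Matrix.diagonal z) k i • M i, ensembleDM_mix _ _ ?_, ?_⟩
  · rw [Matrix.conjTranspose_mul, mul_assoc, ← mul_assoc _ _ (Matrix.diagonal z),
      hadamard_conjTranspose_mul_self, one_mul, Matrix.diagonal_conjTranspose,
      Matrix.diagonal_mul_diagonal, ← Matrix.diagonal_one]
    congr 1
    ext i
    simp [← Complex.normSq_eq_conj_mul_self, Complex.normSq_eq_norm_sq, hz]
  · have h : ∀ k, ‖(∑ i, (hadamard * Matrix.diagonal z) k i • M i).det‖ =
        1 / 4 * ‖∑ i, z i ^ 2 * (M i).det‖ := by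
      intro k
      rw [det_sum_smul hpol]
      have : ∀ i, (hadamard * Matrix.diagonal z) k i ^ 2 * (M i).det =
          1 / 4 * (z i ^ 2 * (M i).det) := by
        intro i
        rw [Matrix.mul_diagonal, mul_pow, hadamard_sq, mul_assoc]
      simp only [this, ← Finset.mul_sum, norm_mul]
      norm_num
    simp only [h, Finset.sum_const, Finset.card_univ, Fintype.card_fin]
    ring

/-- An ensemble whose average concurrence is at most the root of the variance of the Bloch
vector of the first qubit under some projective measurement of the second qubit. -/
def HasGoodEnsemble (ρ : Matrix (Fin 2 × Fin 2) (Fin 2 × Fin 2) ℂ) : Prop :=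
  ∃ M : Fin 4 → Matrix (Fin 2) (Fin 2) ℂ, ensembleDM M = ρ ∧
    ∃ U ∈ Matrix.unitaryGroup (Fin 2) ℂ,
      (∑ i, ‖(M i).det‖) ^ 2 * (outcomeProb ρ U 0 * outcomeProb ρ U 1) ≤
        -((outcomeProb ρ U 1 : ℂ) • condState ρ U 0 -
          (outcomeProb ρ U 0 : ℂ) • condState ρ U 1).det.re

lemma hasGoodEnsemble_of_detPolar_eq_zero {M : Fin 4 → Matrix (Fin 2) (Fin 2) ℂ}
    (hpol : ∀ i j, i ≠ j → detPolar (M i) (M j) = 0) (hdet : ∀ i, (M i).det ≠ 0) :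
    HasGoodEnsemble (ensembleDM M) := by
  choose m hm using fun i => IsAlgClosed.exists_pow_nat_eq (M i).det (n := 2) (by norm_num)
  have hm0 : ∀ i, m i ≠ 0 := fun i h => hdet i (by rw [← hm i, h]; simp)
  set w : Fin 4 → ℝ := fun i => ‖m i‖ ^ 2 with hw
  set N : Fin 4 → Matrix (Fin 2) (Fin 2) ℂ := fun i => (m i)⁻¹ • M i with hN
  have hNdet : ∀ i, (N i).det = 1 := by
    intro i
    simp only [hN, Matrix.det_smul, Fintype.card_fin, ← hm i, inv_pow]
    exact inv_mul_cancel₀ (pow_ne_zero 2 (hm0 i))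
  have hNpol : ∀ i j, i ≠ j → detPolar (N i) (N j) = 0 := by
    intro i j hij
    have := hpol i j hij
    simp only [detPolar, hN, Matrix.smul_apply, smul_eq_mul] at this ⊢
    linear_combination (m i)⁻¹ * (m j)⁻¹ * this
  have hNM : ∀ H, ∑ i, (w i : ℂ) • (N i * H * (N i)ᴴ) = contractSnd (ensembleDM M) H := by
    intro H
    rw [contractSnd_ensembleDM]
    refine Finset.sum_congr rfl fun i _ => ?_
    simp only [hN, hw, Matrix.conjTranspose_smul, smul_mul_assoc, mul_smul_comm, smul_smul]
    rw [show ((‖m i‖ ^ 2 : ℝ) : ℂ) = m i * star (m i) by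
      rw [Complex.star_def, Complex.mul_conj, Complex.normSq_eq_norm_sq]]
    rw [star_inv₀]
    have : star (m i) ≠ 0 := star_ne_zero.2 (hm0 i)
    have h2 := hm0 i
    convert one_smul ℂ _ using 2
    field_simp
  have hphase : ∀ t : Fin 4 → ℂ, (∀ i, ‖t i‖ = 1) → ∃ M' : Fin 4 → Matrix (Fin 2) (Fin 2) ℂ,
      ensembleDM M' = ensembleDM M ∧ ∑ i, ‖(M' i).det‖ = ‖∑ i, t i ^ 2 * (w i : ℂ)‖ := by
    intro t ht
    obtain ⟨M', h1, h2⟩ := exists_ensemble_of_phases hpol (fun i => t i * (‖m i‖ / m i))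
      (fun i => by simp [ht, hm0])
    refine ⟨M', h1, h2.trans ?_⟩
    congr 1
    refine Finset.sum_congr rfl fun i _ => ?_
    have h2 := hm0 i
    rw [← hm i, hw]
    push_cast
    field_simp
  obtain ⟨M', hM', hc1, hc2⟩ : ∃ M' : Fin 4 → Matrix (Fin 2) (Fin 2) ℂ,
      ensembleDM M' = ensembleDM M ∧ ∑ i, ‖(M' i).det‖ ≤ |w 0 + w 1 - w 2 - w 3| ∧
        ∑ i, ‖(M' i).det‖ ≤ |w 0 - w 1 + w 2 - w 3| := by
    rcases le_total |w 0 + w 1 - w 2 - w 3| |w 0 - w 1 + w 2 - w 3| with h | h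
    · obtain ⟨M', h1, h2⟩ := hphase ![1, 1, Complex.I, Complex.I]
        (fun i => by fin_cases i <;> simp)
      have e : ‖∑ i, (![1, 1, Complex.I, Complex.I] : Fin 4 → ℂ) i ^ 2 * (w i : ℂ)‖ =
          |w 0 + w 1 - w 2 - w 3| := by
        rw [← Real.norm_eq_abs, ← Complex.norm_real]
        congr 1
        simp [Fin.sum_univ_four]
        ring
      rw [e] at h2
      exact ⟨M', h1, h2.le, h2.le.trans h⟩
    · obtain ⟨M', h1, h2⟩ := hphase ![1, Complex.I, 1, Complex.I]
        (fun i => by fin_cases i <;> simp)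
      have e : ‖∑ i, (![1, Complex.I, 1, Complex.I] : Fin 4 → ℂ) i ^ 2 * (w i : ℂ)‖ =
          |w 0 - w 1 + w 2 - w 3| := by
        rw [← Real.norm_eq_abs, ← Complex.norm_real]
        congr 1
        simp [Fin.sum_univ_four]
        ring
      rw [e] at h2
      exact ⟨M', h1, h2.le.trans h, h2.le⟩
  obtain ⟨H, hH, htr, hneg, hle⟩ := exists_isHermitian_of_detPolar_eq_zero hNdet hNpol w
    (Finset.sum_nonneg fun i _ => norm_nonneg _) hc1 hc2
  rw [hNM] at htr hle
  exact ⟨M', hM', exists_unitary_of_isHermitian _ hH htr hneg hle⟩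

/-- The matrix of the polarized determinant in the standard basis of `2 × 2` matrices. -/
def detPolarMatrix : Matrix (Fin 2 × Fin 2) (Fin 2 × Fin 2) ℂ :=
  Matrix.of fun x y => if x.1 ≠ y.1 ∧ x.2 ≠ y.2 then (if x.1 = x.2 then 1 else -1) else 0

lemma detPolarMatrix_mul_self : detPolarMatrix * detPolarMatrix = 1 := by
  ext ⟨a, b⟩ ⟨c, d⟩
  fin_cases a <;> fin_cases b <;> fin_cases c <;> fin_cases d <;>
    simp [detPolarMatrix, Matrix.mul_apply, Fintype.sum_prod_type, Fin.sum_univ_two]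

lemma hasGoodEnsemble_of_det_ne_zero {S : Matrix (Fin 2 × Fin 2) (Fin 2 × Fin 2) ℂ}
    (hS : S.det ≠ 0) : HasGoodEnsemble (S * Sᴴ) := by
  let e : Fin 4 ≃ Fin 2 × Fin 2 := (finProdFinEquiv (m := 2) (n := 2)).symm
  let M : Fin 4 → Matrix (Fin 2) (Fin 2) ℂ := fun i => Matrix.of fun a b => S (a, b) (e i)
  have hM : ensembleDM M = S * Sᴴ := by
    ext x y
    simp only [ensembleDM, Matrix.of_apply, Matrix.mul_apply, Matrix.conjTranspose_apply, M]
    exact e.sum_comp fun i => S x i * star (S y i)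
  set τ : Matrix (Fin 4) (Fin 4) ℂ := Matrix.of fun i j => detPolar (M i) (M j) with hτ
  have hτS : τ = (Sᵀ * detPolarMatrix * S).submatrix e e := by
    ext i j
    simp [hτ, M, detPolar, detPolarMatrix, Matrix.mul_apply, Fintype.sum_prod_type,
      Fin.sum_univ_two]
    ring
  have hJ : detPolarMatrix.det ≠ 0 := by
    intro h
    have := congrArg Matrix.det detPolarMatrix_mul_self
    simp [h] at this
  have hτdet : τ.det ≠ 0 := by
    rw [hτS, Matrix.det_submatrix_equiv_self, Matrix.det_mul, Matrix.det_mul,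
      Matrix.det_transpose]
    exact mul_ne_zero (mul_ne_zero hS hJ) hS
  obtain ⟨U, hU, hdiag⟩ := exists_unitary_transpose_mul_mul_diagonal τ (by
    ext i j
    exact detPolar_comm _ _)
  have hU' : U * star U = 1 := Matrix.mem_unitaryGroup_iff.1 hU
  let M' : Fin 4 → Matrix (Fin 2) (Fin 2) ℂ := fun k => ∑ i, Uᵀ k i • M i
  have hM' : ensembleDM M' = ensembleDM M := by
    refine ensembleDM_mix M Uᵀ ?_
    rw [← Matrix.transpose_one, ← hU', Matrix.transpose_mul]
    rfl
  have hpol : ∀ k l, detPolar (M' k) (M' l) = (Uᵀ * τ * U) k l := by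
    intro k l
    simp only [M', detPolar_sum_smul, Matrix.mul_apply, hτ, Matrix.of_apply, Finset.sum_mul,
      Matrix.transpose_apply]
    exact Finset.sum_comm
  rw [← hM, ← hM']
  refine hasGoodEnsemble_of_detPolar_eq_zero (fun i j hij => (hpol i j).trans (hdiag i j hij))
    fun k hk => ?_
  have hD : Uᵀ * τ * U = Matrix.diagonal fun k => (Uᵀ * τ * U) k k := by
    ext i j
    by_cases h : i = j
    · simp [h]
    · rw [hdiag i j h, Matrix.diagonal_apply_ne _ h]
  have h1 : (Uᵀ * τ * U).det = 0 := by
    rw [hD, Matrix.det_diagonal]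
    refine Finset.prod_eq_zero (Finset.mem_univ k) ?_
    rw [← hpol, detPolar_self, hk, mul_zero]
  have hUdet : U.det ≠ 0 := by
    intro h
    have := congrArg Matrix.det hU'
    simp [h] at this
  rw [Matrix.det_mul, Matrix.det_mul, Matrix.det_transpose] at h1
  exact mul_ne_zero (mul_ne_zero hUdet hτdet) hUdet h1

lemma continuous_condState_ensembleDM (k : Fin 2) :
    Continuous fun p : (Fin 4 → Matrix (Fin 2) (Fin 2) ℂ) × Matrix (Fin 2) (Fin 2) ℂ =>
      condState (ensembleDM p.1) p.2 k := by
  refine continuous_matrix fun i j => ?_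
  simp only [condState, contractSnd, ensembleDM, colProj, Matrix.of_apply]
  fun_prop

/-- The ensembles and measurement bases as in `HasGoodEnsemble`, with amplitudes bounded
by `R`. -/
def goodEnsembles (R : ℝ) :
    Set ((Fin 4 → Matrix (Fin 2) (Fin 2) ℂ) × Matrix (Fin 2) (Fin 2) ℂ) :=
  {p | (∀ i a b, ‖p.1 i a b‖ ≤ R) ∧ p.2 ∈ Matrix.unitaryGroup (Fin 2) ℂ ∧
    (∑ i, ‖(p.1 i).det‖) ^ 2 *
        (outcomeProb (ensembleDM p.1) p.2 0 * outcomeProb (ensembleDM p.1) p.2 1) ≤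
      -((outcomeProb (ensembleDM p.1) p.2 1 : ℂ) • condState (ensembleDM p.1) p.2 0 -
        (outcomeProb (ensembleDM p.1) p.2 0 : ℂ) • condState (ensembleDM p.1) p.2 1).det.re}

lemma isCompact_goodEnsembles (R : ℝ) : IsCompact (goodEnsembles R) := by
  have hbox : IsCompact ((Set.univ.pi fun _ : Fin 4 => Set.univ.pi fun _ : Fin 2 =>
      Set.univ.pi fun _ : Fin 2 => Metric.closedBall (0 : ℂ) R) ×ˢ
      (Set.univ.pi fun _ : Fin 2 => Set.univ.pi fun _ : Fin 2 => Metric.closedBall (0 : ℂ) 1)) :=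
    (isCompact_univ_pi fun _ => isCompact_univ_pi fun _ => isCompact_univ_pi fun _ =>
      isCompact_closedBall _ _).prod
      (isCompact_univ_pi fun _ => isCompact_univ_pi fun _ => isCompact_closedBall _ _)
  have hcl : IsClosed (goodEnsembles R) := by
    have hc := continuous_condState_ensembleDM
    have hp : ∀ k, Continuous fun p : (Fin 4 → Matrix (Fin 2) (Fin 2) ℂ) ×
        Matrix (Fin 2) (Fin 2) ℂ => outcomeProb (ensembleDM p.1) p.2 k := fun k =>
      Complex.continuous_re.comp (hc k).matrix_trace
    have hpc := fun k => Complex.continuous_ofReal.comp (hp k)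
    refine IsClosed.and ?_ (IsClosed.and ?_ ?_)
    · simp only [Set.ofPred_forall]
      exact isClosed_iInter fun i => isClosed_iInter fun a => isClosed_iInter fun b =>
        isClosed_le (by fun_prop) continuous_const
    · simp only [Matrix.mem_unitaryGroup_iff]
      exact isClosed_eq (continuous_snd.mul continuous_snd.star) continuous_const
    · refine isClosed_le ?_ ?_
      · refine ((continuous_finsetSum _ fun i _ => ?_).pow 2).mul ((hp 0).mul (hp 1))
        exact (((continuous_apply i).comp continuous_fst).matrix_det).norm
      · exact (Complex.continuous_re.comp
          (((hpc 1).smul (hc 0)).sub ((hpc 0).smul (hc 1))).matrix_det).neg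
  refine hbox.of_isClosed_subset hcl fun p hp =>
    ⟨fun i _ a _ b _ => ?_, fun a _ b _ => ?_⟩
  · simpa using hp.1 i a b
  · simpa using entry_norm_bound_of_unitary hp.2.1 a b

lemma norm_sq_le_of_ensembleDM (M : Fin 4 → Matrix (Fin 2) (Fin 2) ℂ) (i : Fin 4)
    (a b : Fin 2) : ‖M i a b‖ ^ 2 ≤ ‖ensembleDM M (a, b) (a, b)‖ := by
  have h : ensembleDM M (a, b) (a, b) = ((∑ i, ‖M i a b‖ ^ 2 : ℝ) : ℂ) := by
    simp [ensembleDM, Complex.mul_conj, Complex.normSq_eq_norm_sq]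
  rw [h, Complex.norm_real, Real.norm_of_nonneg (by positivity)]
  exact Finset.single_le_sum (f := fun i => ‖M i a b‖ ^ 2) (fun _ _ => by positivity)
    (Finset.mem_univ i)

open scoped MatrixOrder Matrix.Norms.L2Operator in
lemma hasGoodEnsemble_of_posSemidef {ρ : Matrix (Fin 2 × Fin 2) (Fin 2 × Fin 2) ℂ}
    (hρ : ρ.PosSemidef) : HasGoodEnsemble ρ := by
  obtain ⟨S, hS⟩ : ∃ S : Matrix (Fin 2 × Fin 2) (Fin 2 × Fin 2) ℂ, ρ = S * Sᴴ := by
    obtain ⟨B, hB⟩ := CStarAlgebra.nonneg_iff_eq_star_mul_self.mp hρ.nonneg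
    exact ⟨Bᴴ, by rw [hB, Matrix.conjTranspose_conjTranspose, Matrix.star_eq_conjTranspose]⟩
  set R : ℝ := ∑ x, ‖ρ x x‖ + 1 with hR
  have hR1 : 1 ≤ R := by rw [hR]; have : 0 ≤ ∑ x, ‖ρ x x‖ := by positivity
                         linarith
  have hclosed : IsClosed ((fun p => ensembleDM p.1) '' goodEnsembles R) := by
    refine ((isCompact_goodEnsembles R).image ?_).isClosed
    refine continuous_matrix fun i j => ?_
    simp only [ensembleDM, Matrix.of_apply]
    fun_prop
  have hlim : Tendsto (fun t : ℂ => (S + t • 1) * (S + t • 1)ᴴ) (𝓝[≠] 0) (𝓝 ρ) := by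
    have : Continuous fun t : ℂ => (S + t • (1 : Matrix (Fin 2 × Fin 2) (Fin 2 × Fin 2) ℂ)) *
        (S + t • (1 : Matrix (Fin 2 × Fin 2) (Fin 2 × Fin 2) ℂ))ᴴ := by
      fun_prop
    have h0 := this.tendsto 0
    simp only [zero_smul, add_zero, ← hS] at h0
    exact h0.mono_left nhdsWithin_le_nhds
  have hdet : ∀ᶠ t : ℂ in 𝓝[≠] 0,
      (S + t • (1 : Matrix (Fin 2 × Fin 2) (Fin 2 × Fin 2) ℂ)).det ≠ 0 := by
    have h : {t : ℂ | (-S).charpoly.eval t = 0}.Finite :=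
      (-S).charpoly.finite_setOfPred_isRoot (-S).charpoly_monic.ne_zero
    filter_upwards [nhdsNE_le_cofinite 0 h.compl_mem_cofinite] with t ht h0
    refine ht ?_
    rw [Set.mem_ofPred_eq, Matrix.eval_charpoly, sub_neg_eq_add, add_comm,
      Matrix.scalar_apply, ← Matrix.smul_one_eq_diagonal]
    exact h0
  have hbd : ∀ᶠ t : ℂ in 𝓝[≠] 0, ∀ x, ‖((S + t • (1 : Matrix (Fin 2 × Fin 2) (Fin 2 × Fin 2) ℂ)) *
      (S + t • (1 : Matrix (Fin 2 × Fin 2) (Fin 2 × Fin 2) ℂ))ᴴ) x x‖ < R := by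
    refine eventually_all.2 fun x => ?_
    have h := (((continuous_apply_apply x x).tendsto ρ).comp hlim).norm
    refine h.eventually (gt_mem_nhds ?_)
    have := Finset.single_le_sum (f := fun x => ‖ρ x x‖) (fun _ _ => norm_nonneg _)
      (Finset.mem_univ x)
    rw [hR]
    linarith
  have hmem : ρ ∈ (fun p => ensembleDM p.1) '' goodEnsembles R := by
    refine hclosed.mem_of_tendsto hlim ?_
    filter_upwards [hdet, hbd] with t ht hb
    obtain ⟨M, hM, U, hU, hle⟩ := hasGoodEnsemble_of_det_ne_zero ht
    refine ⟨(M, U), ⟨fun i a b => ?_, hU, by rw [hM]; exact hle⟩, hM⟩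
    have h1 := norm_sq_le_of_ensembleDM M i a b
    rw [hM] at h1
    have h2 := hb (a, b)
    nlinarith [norm_nonneg (M i a b)]
  obtain ⟨⟨M, U⟩, ⟨_, hU, hle⟩, hM⟩ := hmem
  simp only at hM hle hU
  rw [hM] at hle
  exact ⟨M, hM, U, hU, hle⟩

/-- `ρ` is the density matrix of an ensemble with total pure-state concurrence `c`. -/
def HasEnsembleConc (ρ : Matrix (Fin 2 × Fin 2) (Fin 2 × Fin 2) ℂ) (c : ℝ) : Prop :=
  ∃ (n : ℕ) (M : Fin n → Matrix (Fin 2) (Fin 2) ℂ),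
    ensembleDM M = ρ ∧ ∑ i, 2 * ‖(M i).det‖ = c

lemma hasEnsembleConc_ensembleDM {ι : Type*} [Fintype ι] (M : ι → Matrix (Fin 2) (Fin 2) ℂ) :
    HasEnsembleConc (ensembleDM M) (∑ i, 2 * ‖(M i).det‖) := by
  let e := (Fintype.equivFin ι).symm
  refine ⟨_, M ∘ e, ?_, e.sum_comp fun i => 2 * ‖(M i).det‖⟩
  ext x y
  exact e.sum_comp fun i => M i x.1 x.2 * star (M i y.1 y.2)

lemma HasEnsembleConc.add {ρ ρ' : Matrix (Fin 2 × Fin 2) (Fin 2 × Fin 2) ℂ} {c c' : ℝ}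
    (h : HasEnsembleConc ρ c) (h' : HasEnsembleConc ρ' c') :
    HasEnsembleConc (ρ + ρ') (c + c') := by
  obtain ⟨n, M, rfl, rfl⟩ := h
  obtain ⟨n', M', rfl, rfl⟩ := h'
  convert hasEnsembleConc_ensembleDM (Sum.elim M M')
  · ext x y
    simp [ensembleDM]
  · simp

lemma ensembleDM_posSemidef {ι : Type*} [Fintype ι] (M : ι → Matrix (Fin 2) (Fin 2) ℂ) :
    (ensembleDM M).PosSemidef :=
  Matrix.posSemidef_self_mul_conjTranspose
    (Matrix.of fun (x : Fin 2 × Fin 2) i => M i x.1 x.2)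

/-- The reduced density matrix of qubit `A` and the `j`-th of the qubits `B`. -/
def reducedPair {k : ℕ} (j : Fin k) (ψ : Fin 2 → (Fin k → Fin 2) → ℂ) :
    Matrix (Fin 2 × Fin 2) (Fin 2 × Fin 2) ℂ :=
  Matrix.of fun x y => ∑ g : Fin k → Fin 2,
    if g j = x.2 then ψ x.1 g * star (ψ y.1 (Function.update g j y.2)) else 0

/-- The reduced density matrix of qubit `A`. -/
def reducedFst {k : ℕ} (ψ : Fin 2 → (Fin k → Fin 2) → ℂ) : Matrix (Fin 2) (Fin 2) ℂ :=
  Matrix.of fun a a' => ∑ g, ψ a g * star (ψ a' g)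

/-- The unnormalized state after outcome `m` of a measurement of the first qubit `B` in the
basis of columns of `U`. -/
def measureFst {k : ℕ} (U : Matrix (Fin 2) (Fin 2) ℂ) (m : Fin 2)
    (ψ : Fin 2 → (Fin (k + 1) → Fin 2) → ℂ) (a : Fin 2) (f : Fin k → Fin 2) : ℂ :=
  ∑ b, ψ a (Fin.cons b f) * U b m

/-- The matrix of amplitudes of qubit `A` and the first qubit `B`, for fixed values of the
other qubits. -/
def sliceFst {k : ℕ} (ψ : Fin 2 → (Fin (k + 1) → Fin 2) → ℂ) (f : Fin k → Fin 2) :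
    Matrix (Fin 2) (Fin 2) ℂ :=
  Matrix.of fun a b => ψ a (Fin.cons b f)

lemma sum_cons {k : ℕ} (F : (Fin (k + 1) → Fin 2) → ℂ) :
    ∑ g, F g = ∑ b, ∑ f : Fin k → Fin 2, F (Fin.cons b f) := by
  rw [← (Fin.consEquiv fun _ : Fin (k + 1) => Fin 2).sum_comp, Fintype.sum_prod_type]
  rfl

lemma reducedPair_zero {k : ℕ} (ψ : Fin 2 → (Fin (k + 1) → Fin 2) → ℂ) :
    reducedPair 0 ψ = ensembleDM (sliceFst ψ) := by
  ext x y
  simp only [reducedPair, Matrix.of_apply, sum_cons, Fin.cons_zero, ensembleDM, sliceFst]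
  rw [Finset.sum_eq_single x.2 (fun b _ hb => by simp [hb]) (by simp)]
  simp [Fin.update_cons_zero]

lemma condState_reducedPair_zero {k : ℕ} (ψ : Fin 2 → (Fin (k + 1) → Fin 2) → ℂ)
    (U : Matrix (Fin 2) (Fin 2) ℂ) (m : Fin 2) :
    condState (reducedPair 0 ψ) U m = reducedFst (measureFst U m ψ) := by
  rw [reducedPair_zero, condState, contractSnd_ensembleDM]
  ext a a'
  simp only [Matrix.sum_apply, reducedFst, Matrix.of_apply]
  refine Finset.sum_congr rfl fun f _ => ?_
  simp only [Matrix.mul_apply, colProj, sliceFst, measureFst, Fin.sum_univ_two, Matrix.of_apply,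
    Matrix.conjTranspose_apply, star_add, star_mul']
  ring

lemma sum_measureFst_mul_star {k : ℕ} (ψ : Fin 2 → (Fin (k + 1) → Fin 2) → ℂ)
    {U : Matrix (Fin 2) (Fin 2) ℂ} (hU : U ∈ Matrix.unitaryGroup (Fin 2) ℂ)
    (a a' : Fin 2) (f f' : Fin k → Fin 2) :
    measureFst U 0 ψ a f * star (measureFst U 0 ψ a' f') +
        measureFst U 1 ψ a f * star (measureFst U 1 ψ a' f') =
      ∑ b, ψ a (Fin.cons b f) * star (ψ a' (Fin.cons b f')) := by
  have h : ∀ b b', U b 0 * star (U b' 0) + U b 1 * star (U b' 1) =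
      (1 : Matrix (Fin 2) (Fin 2) ℂ) b b' := by
    intro b b'
    rw [← Matrix.mem_unitaryGroup_iff.1 hU, Matrix.mul_apply, Fin.sum_univ_two]
    rfl
  have h00 := h 0 0
  have h01 := h 0 1
  have h10 := h 1 0
  have h11 := h 1 1
  simp only [Matrix.one_apply, Fin.isValue, if_true, zero_ne_one, one_ne_zero, if_false]
    at h00 h01 h10 h11
  simp only [measureFst, Fin.sum_univ_two, star_add, star_mul']
  linear_combination
    ψ a (Fin.cons 0 f) * star (ψ a' (Fin.cons 0 f')) * h00 +
    ψ a (Fin.cons 0 f) * star (ψ a' (Fin.cons 1 f')) * h01 +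
    ψ a (Fin.cons 1 f) * star (ψ a' (Fin.cons 0 f')) * h10 +
    ψ a (Fin.cons 1 f) * star (ψ a' (Fin.cons 1 f')) * h11

lemma reducedFst_eq_add {k : ℕ} (ψ : Fin 2 → (Fin (k + 1) → Fin 2) → ℂ)
    {U : Matrix (Fin 2) (Fin 2) ℂ} (hU : U ∈ Matrix.unitaryGroup (Fin 2) ℂ) :
    reducedFst ψ = reducedFst (measureFst U 0 ψ) + reducedFst (measureFst U 1 ψ) := by
  ext a a'
  simp only [reducedFst, Matrix.add_apply, Matrix.of_apply, ← Finset.sum_add_distrib,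
    sum_measureFst_mul_star ψ hU, sum_cons]
  exact Finset.sum_comm

lemma reducedPair_succ_eq_add {k : ℕ} (j : Fin k) (ψ : Fin 2 → (Fin (k + 1) → Fin 2) → ℂ)
    {U : Matrix (Fin 2) (Fin 2) ℂ} (hU : U ∈ Matrix.unitaryGroup (Fin 2) ℂ) :
    reducedPair j.succ ψ =
      reducedPair j (measureFst U 0 ψ) + reducedPair j (measureFst U 1 ψ) := by
  ext x y
  simp only [reducedPair, Matrix.add_apply, Matrix.of_apply, ← Finset.sum_add_distrib, sum_cons,
    Fin.cons_succ, ← Fin.cons_update]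
  rw [Finset.sum_comm]
  refine Finset.sum_congr rfl fun f _ => ?_
  split_ifs
  · rw [sum_measureFst_mul_star ψ hU]
  · simp

lemma trace_reducedFst {k : ℕ} (ψ : Fin 2 → (Fin k → Fin 2) → ℂ) :
    (reducedFst ψ).trace.re = ∑ a, ∑ g, ‖ψ a g‖ ^ 2 := by
  simp [Matrix.trace, reducedFst, Complex.mul_conj, Complex.normSq_eq_norm_sq,
    -Complex.ofReal_pow]

lemma eq_zero_of_trace_reducedFst {k : ℕ} {ψ : Fin 2 → (Fin k → Fin 2) → ℂ}
    (h : (reducedFst ψ).trace.re = 0) (a : Fin 2) (g : Fin k → Fin 2) : ψ a g = 0 := by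
  rw [trace_reducedFst, Finset.sum_eq_zero_iff_of_nonneg fun _ _ => by positivity] at h
  have h2 := h a (Finset.mem_univ a)
  rw [Finset.sum_eq_zero_iff_of_nonneg fun _ _ => by positivity] at h2
  simpa using h2 g (Finset.mem_univ g)

lemma reducedFst_eq_zero {k : ℕ} {ψ : Fin 2 → (Fin k → Fin 2) → ℂ}
    (h : (reducedFst ψ).trace.re = 0) : reducedFst ψ = 0 := by
  ext a a'
  simp [reducedFst, eq_zero_of_trace_reducedFst h]

lemma det_add_mul_mul (R S : Matrix (Fin 2) (Fin 2) ℂ) (p q : ℝ) :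
    (R + S).det.re * (p * q) = (p + q) * (q * R.det.re + p * S.det.re) -
      ((q : ℂ) • R - (p : ℂ) • S).det.re := by
  have h : (R + S).det * (p * q) = (p + q) * (q * R.det + p * S.det) -
      ((q : ℂ) • R - (p : ℂ) • S).det := by
    simp only [Matrix.det_fin_two, Matrix.add_apply, Matrix.sub_apply, Matrix.smul_apply,
      smul_eq_mul]
    ring
  have h2 := congrArg Complex.re h
  simpa only [← Complex.ofReal_mul, ← Complex.ofReal_add, Complex.re_mul_ofReal,
    Complex.re_ofReal_mul, Complex.add_re, Complex.sub_re] using h2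

lemma hasEnsembleConc_zero_of_measureFst_eq_zero {k : ℕ}
    {ψ : Fin 2 → (Fin (k + 1) → Fin 2) → ℂ}
    {U : Matrix (Fin 2) (Fin 2) ℂ} (hU : U ∈ Matrix.unitaryGroup (Fin 2) ℂ) {m : Fin 2}
    (h : ∀ a f, measureFst U m ψ a f = 0) : HasEnsembleConc (reducedPair 0 ψ) 0 := by
  rw [reducedPair_zero]
  convert hasEnsembleConc_ensembleDM (sliceFst ψ)
  refine (Finset.sum_eq_zero fun f _ => ?_).symm
  have h1 : (sliceFst ψ f * U).det = 0 := Matrix.det_eq_zero_of_column_eq_zero m fun a => h a f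
  have hUdet : U.det ≠ 0 := by
    intro h0
    have := congrArg Matrix.det (Matrix.mem_unitaryGroup_iff.1 hU)
    simp [h0] at this
  rw [Matrix.det_mul] at h1
  simp [(mul_eq_zero.1 h1).resolve_right hUdet]

theorem exists_hasEnsembleConc_reducedPair {k : ℕ} (ψ : Fin 2 → (Fin k → Fin 2) → ℂ) :
    ∃ c : Fin k → ℝ, (∀ j, HasEnsembleConc (reducedPair j ψ) (c j)) ∧
      ∑ j, c j ^ 2 ≤ 4 * (reducedFst ψ).det.re := by
  induction k with
  | zero =>
    refine ⟨0, fun j => j.elim0, ?_⟩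
    simp only [reducedFst, Matrix.det_fin_two, Matrix.of_apply, Finset.univ_unique,
      Finset.sum_singleton, Finset.univ_eq_empty, Finset.sum_empty]
    rw [mul_mul_mul_comm, mul_comm (star _), mul_mul_mul_comm, sub_self]
    simp
  | succ k ih =>
    obtain ⟨M, hM, U, hU, hle⟩ := hasGoodEnsemble_of_posSemidef
      (reducedPair_zero ψ ▸ ensembleDM_posSemidef (sliceFst ψ))
    obtain ⟨x, hx, hx'⟩ := ih (measureFst U 0 ψ)
    obtain ⟨y, hy, hy'⟩ := ih (measureFst U 1 ψ)
    simp only [outcomeProb, condState_reducedPair_zero] at hle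
    have hxy : ∀ j : Fin k, HasEnsembleConc (reducedPair j.succ ψ) (x j + y j) := fun j => by
      rw [reducedPair_succ_eq_add j ψ hU]
      exact (hx j).add (hy j)
    have hsum : ∀ z : Fin k → ℝ, ∑ j, z j ^ 2 ≤ 0 → ∀ j, z j = 0 := fun z hz j => by
      have h := (Finset.sum_eq_zero_iff_of_nonneg fun _ _ => sq_nonneg _).1
        (hz.antisymm (Finset.sum_nonneg fun _ _ => sq_nonneg _)) j (Finset.mem_univ j)
      simpa using h
    have hnonneg : ∀ m, 0 ≤ (reducedFst (measureFst U m ψ)).trace.re := fun m => by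
      rw [trace_reducedFst]
      positivity
    rw [reducedFst_eq_add ψ hU]
    rcases (hnonneg 0).eq_or_lt with h0 | h0
    · have hz := eq_zero_of_trace_reducedFst h0.symm
      rw [reducedFst_eq_zero h0.symm] at hx' ⊢
      have hx0 := hsum x (by simpa using hx')
      refine ⟨Fin.cons 0 fun j => x j + y j,
        Fin.cases (hasEnsembleConc_zero_of_measureFst_eq_zero hU hz) hxy, ?_⟩
      simpa [Fin.sum_univ_succ, hx0] using hy'
    rcases (hnonneg 1).eq_or_lt with h1 | h1
    · have hz := eq_zero_of_trace_reducedFst h1.symm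
      rw [reducedFst_eq_zero h1.symm] at hy' ⊢
      have hy0 := hsum y (by simpa using hy')
      refine ⟨Fin.cons 0 fun j => x j + y j,
        Fin.cases (hasEnsembleConc_zero_of_measureFst_eq_zero hU hz) hxy, ?_⟩
      simpa [Fin.sum_univ_succ, hy0] using hx'
    refine ⟨Fin.cons (∑ i, 2 * ‖(M i).det‖) fun j => x j + y j, Fin.cases ⟨4, M, hM, rfl⟩ hxy, ?_⟩
    set p := (reducedFst (measureFst U 0 ψ)).trace.re
    set q := (reducedFst (measureFst U 1 ψ)).trace.re
    have hdet := det_add_mul_mul (reducedFst (measureFst U 0 ψ))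
      (reducedFst (measureFst U 1 ψ)) p q
    have hcs : (∑ j, (x j + y j) ^ 2) * (p * q) ≤
        (p + q) * (q * ∑ j, x j ^ 2 + p * ∑ j, y j ^ 2) := by
      rw [Finset.mul_sum, Finset.mul_sum, ← Finset.sum_add_distrib, Finset.mul_sum,
        Finset.sum_mul]
      exact Finset.sum_le_sum fun j _ => by nlinarith [sq_nonneg (q * x j - p * y j)]
    have hmono : (p + q) * (q * ∑ j, x j ^ 2 + p * ∑ j, y j ^ 2) ≤
        (p + q) * (q * (4 * (reducedFst (measureFst U 0 ψ)).det.re) +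
          p * (4 * (reducedFst (measureFst U 1 ψ)).det.re)) := by
      gcongr
    refine le_of_mul_le_mul_right ?_ (mul_pos h0 h1)
    simp only [Fin.sum_univ_succ, Fin.cons_zero, Fin.cons_succ, ← Finset.mul_sum] at hle ⊢
    nlinarith

lemma trSq_eq_of_trace_eq_one {R : Matrix (Fin 2) (Fin 2) ℂ} (h : R.trace = 1) :
    trSq R = 1 - 2 * R.det.re := by
  have h2 : (R * R).trace = R.trace ^ 2 - 2 * R.det := by
    simp only [Matrix.trace_fin_two, Matrix.mul_apply, Fin.sum_univ_two, Matrix.det_fin_two]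
    ring
  rw [trSq, h2, h]
  simp

lemma pureConc_eq_of_norm_eq_one {φ : Fin 2 × Fin 2 → ℂ} (h : ∑ x, ‖φ x‖ ^ 2 = 1) :
    pureConc φ = 2 * ‖(Matrix.of fun a b => φ (a, b)).det‖ := by
  set F : Matrix (Fin 2) (Fin 2) ℂ := Matrix.of fun a b => φ (a, b) with hF
  have hR : ptraceRight (pureDM φ) = F * Fᴴ := by
    ext a b
    simp [ptraceRight, pureDM, Matrix.mul_apply, F]
  have htr : (F * Fᴴ).trace = 1 := by
    rw [← Complex.ofReal_one, ← h]
    simp [Matrix.trace, Matrix.mul_apply, hF, Fintype.sum_prod_type, Complex.mul_conj,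
      Complex.normSq_eq_norm_sq]
  have hdet : (F * Fᴴ).det.re = ‖F.det‖ ^ 2 := by
    rw [Matrix.det_mul, Matrix.det_conjTranspose, Complex.star_def, Complex.mul_conj,
      Complex.normSq_eq_norm_sq, Complex.ofReal_re]
  rw [pureConc, hR, trSq_eq_of_trace_eq_one htr, hdet,
    show 2 * (1 - (1 - 2 * ‖F.det‖ ^ 2)) = (2 * ‖F.det‖) ^ 2 by ring,
    Real.sqrt_sq (by positivity)]

lemma conc_nonneg {S T : Type*} [Fintype S] [Fintype T] (ρ : Matrix (S × T) (S × T) ℂ) :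
    0 ≤ conc ρ := by
  refine Real.sInf_nonneg ?_
  rintro c ⟨n, p, φ, hp, -, -, -, rfl⟩
  exact Finset.sum_nonneg fun i _ => mul_nonneg (hp i) (Real.sqrt_nonneg _)

lemma exists_normalized (M : Matrix (Fin 2) (Fin 2) ℂ) :
    ∃ φ : Fin 2 × Fin 2 → ℂ, ∑ x, ‖φ x‖ ^ 2 = 1 ∧
      ∀ a b, M a b = (√(∑ x : Fin 2 × Fin 2, ‖M x.1 x.2‖ ^ 2) : ℂ) * φ (a, b) := by
  set s := ∑ x : Fin 2 × Fin 2, ‖M x.1 x.2‖ ^ 2 with hs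
  have hs0 : 0 ≤ s := by positivity
  rcases hs0.eq_or_lt with h | h
  · refine ⟨Pi.single (0, 0) 1, by simp [Fintype.sum_prod_type, Pi.single_apply], fun a b => ?_⟩
    have h2 := (Finset.sum_eq_zero_iff_of_nonneg fun _ _ => by positivity).1 h.symm (a, b)
      (Finset.mem_univ _)
    have h3 : M a b = 0 := by simpa using h2
    simp [← h, h3]
  · have hr : √s ≠ 0 := (Real.sqrt_pos.2 h).ne'
    refine ⟨fun x => (√s : ℂ)⁻¹ * M x.1 x.2, ?_, fun a b => ?_⟩
    · simp only [norm_mul, mul_pow, ← Finset.mul_sum, norm_inv, Complex.norm_real,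
        Real.norm_eq_abs, inv_pow, sq_abs, Real.sq_sqrt hs0, ← hs]
      exact inv_mul_cancel₀ h.ne'
    · rw [mul_inv_cancel_left₀ (Complex.ofReal_ne_zero.2 hr)]

lemma HasEnsembleConc.conc_sq_le {ρ : Matrix (Fin 2 × Fin 2) (Fin 2 × Fin 2) ℂ} {c : ℝ}
    (h : HasEnsembleConc ρ c) (hρ : ρ.trace = 1) : conc ρ ^ 2 ≤ c ^ 2 := by
  refine pow_le_pow_left₀ (conc_nonneg ρ) ?_ 2
  obtain ⟨n, M, rfl, rfl⟩ := h
  choose φ hφ hM using fun i => exists_normalized (M i)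
  set p : Fin n → ℝ := fun i => ∑ x : Fin 2 × Fin 2, ‖M i x.1 x.2‖ ^ 2 with hp
  have hM' : ∀ i a b, M i a b = (√(p i) : ℂ) * φ i (a, b) := hM
  have hp0 : ∀ i, 0 ≤ p i := fun i => by positivity
  have hsq : ∀ i, (√(p i) : ℂ) * (√(p i) : ℂ) = (p i : ℂ) := fun i => by
    rw [← Complex.ofReal_mul, Real.mul_self_sqrt (hp0 i)]
  refine csInf_le ⟨0, ?_⟩ ⟨n, p, φ, hp0, ?_, hφ, ?_, ?_⟩
  · rintro c ⟨n, p, φ, hp, -, -, -, rfl⟩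
    exact Finset.sum_nonneg fun i _ => mul_nonneg (hp i) (Real.sqrt_nonneg _)
  · rw [← Complex.ofReal_inj, Complex.ofReal_one, ← hρ, Matrix.trace]
    simp only [Matrix.diag_apply, ensembleDM, Matrix.of_apply, Complex.star_def,
      Complex.mul_conj, Complex.normSq_eq_norm_sq, hp]
    push_cast
    exact Finset.sum_comm
  · ext x y
    simp only [ensembleDM, Matrix.of_apply, Matrix.sum_apply, Matrix.smul_apply, pureDM,
      smul_eq_mul, hM', star_mul', Complex.star_def, Complex.conj_ofReal]
    refine Finset.sum_congr rfl fun i _ => ?_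
    rw [← hsq]
    ring
  · refine Finset.sum_congr rfl fun i _ => ?_
    have hdet : (M i).det = (p i : ℂ) * (Matrix.of fun a b => φ i (a, b)).det := by
      simp only [Matrix.det_fin_two, Matrix.of_apply, hM']
      rw [← hsq]
      ring
    rw [pureConc_eq_of_norm_eq_one (hφ i), hdet, norm_mul, Complex.norm_real,
      Real.norm_of_nonneg (hp0 i)]
    ring

/-- An `N`-qubit state as an array indexed by qubit `A` and the qubits `B`. -/
def splitFst {k : ℕ} (ψ : (Fin (k + 1) → Fin 2) → ℂ) (a : Fin 2) (g : Fin k → Fin 2) : ℂ :=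
  ψ (Fin.cons a g)

lemma trace_reducedFst_splitFst {k : ℕ} {ψ : (Fin (k + 1) → Fin 2) → ℂ}
    (h : ∑ x, ‖ψ x‖ ^ 2 = 1) : (reducedFst (splitFst ψ)).trace = 1 := by
  rw [← Complex.ofReal_one, ← h]
  simp [Matrix.trace, reducedFst, Complex.mul_conj, Complex.normSq_eq_norm_sq, splitFst, sum_cons]

lemma trace_reducedPair {k : ℕ} (j : Fin k) (ψ : Fin 2 → (Fin k → Fin 2) → ℂ) :
    (reducedPair j ψ).trace = (reducedFst ψ).trace := by
  simp only [Matrix.trace, Matrix.diag_apply, reducedPair, reducedFst, Matrix.of_apply,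
    Fintype.sum_prod_type]
  refine Finset.sum_congr rfl fun a _ => ?_
  rw [Finset.sum_comm]
  refine Finset.sum_congr rfl fun g _ => ?_
  rw [Finset.sum_eq_single (g j) (fun b _ hb => if_neg hb.symm) (by simp)]
  simp

lemma assemble2_zero_succ {k : ℕ} (i : Fin k) (a b b' : Fin 2)
    (f : {l : Fin (k + 1) // l ≠ 0 ∧ l ≠ i.succ} → Fin 2) (a' : Fin 2) :
    assemble2 0 i.succ a' b' f =
      Fin.cons a' (Function.update (fun l : Fin k => assemble2 0 i.succ a b f l.succ) i b') := by
  ext l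
  refine Fin.cases ?_ (fun l => ?_) l
  · simp [assemble2]
  · by_cases h : l = i
    · subst h
      simp [assemble2]
    · simp [assemble2, h]

lemma rdm2_eq_reducedPair {k : ℕ} (i : Fin k) (ψ : (Fin (k + 1) → Fin 2) → ℂ) :
    rdm2 0 i.succ ψ = reducedPair i (splitFst ψ) := by
  ext ⟨a, b⟩ ⟨a', b'⟩
  simp only [rdm2, reducedPair, Matrix.of_apply, ← Finset.sum_filter]
  refine Finset.sum_bij' (fun f _ l => assemble2 0 i.succ a b f l.succ)
    (fun g _ l => (Fin.cons a g : Fin (k + 1) → Fin 2) l) ?_ ?_ ?_ ?_ ?_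
  · intro f _
    simp [assemble2]
  · simp
  · intro f _
    ext ⟨l, hl, hl'⟩
    obtain ⟨l, rfl⟩ := Fin.exists_succ_eq.2 hl
    simp only [Fin.cons_succ, assemble2, dif_neg hl, dif_neg hl']
  · intro g hg
    have hg : g i = b := by simpa using hg
    ext l
    by_cases h : l = i
    · subst h
      simp [assemble2, hg]
    · simp [assemble2, h]
  · intro f _
    have h : Function.update (fun l : Fin k => assemble2 0 i.succ a b f l.succ) i b =
        fun l : Fin k => assemble2 0 i.succ a b f l.succ := by
      rw [Function.update_eq_self_iff]
      simp [assemble2]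
    rw [splitFst, splitFst, ← assemble2_zero_succ, ← h, ← assemble2_zero_succ]
    rfl

lemma four_mul_det_le_pureConc_sq {S T : Type*} {_ : Fintype S} {_ : Fintype T} {φ : S × T → ℂ}
    {R : Matrix (Fin 2) (Fin 2) ℂ} (e : S ≃ Fin 2)
    (hR : ptraceRight (pureDM φ) = R.submatrix e e) (h : R.trace = 1) :
    4 * R.det.re ≤ pureConc φ ^ 2 := by
  have htr : trSq (R.submatrix e e) = trSq R := by
    rw [trSq, trSq, Matrix.submatrix_mul_equiv]
    exact congrArg Complex.re (e.sum_comp fun i => (R * R) i i)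
  rw [pureConc, hR, htr, trSq_eq_of_trace_eq_one h]
  rcases le_total 0 R.det.re with h0 | h0
  · rw [Real.sq_sqrt (by linarith)]
    linarith
  · exact (by linarith : 4 * R.det.re ≤ 0).trans (sq_nonneg _)

lemma four_mul_det_le_qubitCut_sq {k : ℕ} {ψ : (Fin (k + 1) → Fin 2) → ℂ}
    (h : ∑ x, ‖ψ x‖ ^ 2 = 1) :
    4 * (reducedFst (splitFst ψ)).det.re ≤ qubitCut (fun i : Fin (k + 1) => i = 0) ψ ^ 2 := by
  let e : ({i : Fin (k + 1) // i = 0} → Fin 2) ≃ Fin 2 := Equiv.funUnique _ _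
  unfold qubitCut
  refine four_mul_det_le_pureConc_sq e ?_ (trace_reducedFst_splitFst h)
  ext s s'
  have key : ∀ s (t : {i : Fin (k + 1) // ¬ i = 0} → Fin 2),
      (Equiv.piEquivPiSubtypeProd (fun i : Fin (k + 1) => i = 0) (fun _ => Fin 2)).symm (s, t) =
        Fin.cons (e s) fun l => t ⟨l.succ, Fin.succ_ne_zero l⟩ := by
    intro s t
    ext l
    refine Fin.cases ?_ (fun l => ?_) l
    · simp [Equiv.piEquivPiSubtypeProd, e]
      rfl
    · simp [Equiv.piEquivPiSubtypeProd]
  simp only [ptraceRight, pureDM, key, Matrix.submatrix_apply, reducedFst, Matrix.of_apply,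
    splitFst]
  exact Fintype.sum_equiv
    (Equiv.arrowCongr (finSuccAboveEquiv (0 : Fin (k + 1))).symm (Equiv.refl _)) _ _
    fun t => rfl

end

/-- Generalized Coffman–Kundu–Wootters monogamy inequality:
`C²(ψ_{A|B₁…B_{N-1}}) ≥ ∑ᵢ C²(ρ_{AB_i})`.
Qubits: `A = 0`, `B_i = i` for `i = 1, …, N - 1`. -/
theorem monogamy_squared_concurrence_CKW
    (N : ℕ) (hN : 2 ≤ N) (ψ : (Fin N → Fin 2) → ℂ)
    (hψ : ∑ x, ‖ψ x‖ ^ 2 = 1) :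
    (qubitCut (fun i : Fin N => i = (⟨0, by omega⟩ : Fin N)) ψ) ^ 2 ≥
      ∑ i : Fin (N - 1), (conc (rdm2 (⟨0, by omega⟩ : Fin N) (⟨(i : ℕ) + 1, by have := i.isLt; omega⟩ : Fin N) ψ)) ^ 2 := by
  obtain ⟨k, rfl⟩ : ∃ k, N = k + 1 := ⟨N - 1, by omega⟩
  obtain ⟨c, hc, hle⟩ := exists_hasEnsembleConc_reducedPair (splitFst ψ)
  refine le_trans ?_ (hle.trans (four_mul_det_le_qubitCut_sq hψ))
  refine Finset.sum_le_sum fun i _ => ?_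
  have h := (hc i).conc_sq_le ((trace_reducedPair i _).trans (trace_reducedFst_splitFst hψ))
  rw [← rdm2_eq_reducedPair] at h
  exact h

end
end
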